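/- Let n ≥ 1 and let G₁, …, G_n be groups, each of which is either finite or cyclic (possibly infinite cyclic). Then the free product G = G₁ ∗ ⋯ ∗ G_n has the strong topological Rokhlin property. Moreover, strongly projectively isolated subshifts are dense over G: for every finite set A with at least two elements, every subshift X ⊆ A^G, and every finite set F ⊆ G there exists a strongly projectively isolated subshift X' ⊆ A^G with X'_F = X_F. -/

import Mathlib

open Topology

/-- The Cantor space `𝒞`. -/
abbrev Cantor : Type := ℕ → Bool

/-- `α : G → C(𝒞,𝒞)` is a continuous action if it is a homomorphism into the
self-homeomorphisms of `𝒞` (recorded as continuous maps; continuity of the inverse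
`α g⁻¹` is automatic from the homomorphism equations). -/
def IsAction (G : Type) [Group G] (α : G → C(Cantor, Cantor)) : Prop :=
  α 1 = ContinuousMap.id Cantor ∧ ∀ g h : G, α (g * h) = (α g).comp (α h)

/-- The space `Act_G(𝒞)` of continuous actions of `G` on the Cantor space,
topologized as a subspace of `C(𝒞,𝒞)^G` (compact-open topology on each factor). -/
abbrev ActSpace (G : Type) [Group G] : Type :=
  {α : G → C(Cantor, Cantor) // IsAction G α}

/-- The conjugacy class of an action `α` under the conjugation action of `Homeo(𝒞)`. -/
def conjClass {G : Type} [Group G] (α : ActSpace G) : Set (ActSpace G) :=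
  {β | ∃ φ : Cantor ≃ₜ Cantor, ∀ g : G,
    (β.1 g : Cantor → Cantor) = φ ∘ (α.1 g : Cantor → Cantor) ∘ φ.symm}

/-- The strong topological Rokhlin property: some action on the Cantor space has a
comeager conjugacy class. -/
def HasSTRP (G : Type) [Group G] : Prop :=
  ∃ α : ActSpace G, conjClass α ∈ residual (ActSpace G)

/-- The shift action of `G` on `A^G`: `(g • x)(h) = x(g⁻¹h)`. -/
def shift {G : Type} [Group G] {A : Type} (g : G) (x : G → A) : G → A :=
  fun h => x (g⁻¹ * h)

/-- A subshift: closed (in the product of discrete topologies) and shift-invariant. -/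
def IsSubshift (G : Type) [Group G] (A : Type) (X : Set (G → A)) : Prop :=
  (letI : TopologicalSpace A := ⊥; IsClosed X) ∧ ∀ g : G, ∀ x ∈ X, shift g x ∈ X

/-- The set `X_F` of `F`-patterns of `X`. -/
def patterns {G A : Type} (F : Finset G) (X : Set (G → A)) : Set (F → A) :=
  (fun (x : G → A) (f : F) => x (f : G)) '' X

/-- Subshift of finite type, with defining window `E` and allowed patterns `𝔽`. -/
def IsSFT (G : Type) [Group G] (A : Type) (X : Set (G → A)) : Prop :=
  ∃ (E : Finset G) (𝔽 : Set (E → A)),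
    ∀ x : G → A, x ∈ X ↔ ∀ g : G, (fun e : E => shift g x (e : G)) ∈ 𝔽

/-- Continuity on a set, for a map between full shift spaces over discrete alphabets. -/
def ContinuousOnD {G A B : Type} (ψ : (G → B) → (G → A)) (Z : Set (G → B)) : Prop :=
  letI : TopologicalSpace A := ⊥
  letI : TopologicalSpace B := ⊥
  ContinuousOn ψ Z

/-- `G`-equivariance of a map between shift spaces, on a set. -/
def EquivariantOn {G A B : Type} [Group G] (ψ : (G → B) → (G → A)) (Z : Set (G → B)) : Prop :=
  ∀ g : G, ∀ z ∈ Z, ψ (shift g z) = shift g (ψ z)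

/-- A sofic subshift: a continuous `G`-equivariant image of a subshift of finite type. -/
def IsSofic (G : Type) [Group G] (A : Type) (X : Set (G → A)) : Prop :=
  ∃ (B : Type) (_ : Fintype B) (_ : Nontrivial B) (Z : Set (G → B))
    (ψ : (G → B) → (G → A)),
    IsSubshift G B Z ∧ IsSFT G B Z ∧ ContinuousOnD ψ Z ∧ EquivariantOn ψ Z ∧ ψ '' Z = X

/-- The sliding block code `Φ(y)(g) = f(d ↦ y(g·d))` induced by `f : (D → B) → A`. -/
def slidingBlock {G : Type} [Group G] {A B : Type} (D : Finset G)
    (f : (D → B) → A) : (G → B) → (G → A) :=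
  fun y g => f (fun d => y (g * (d : G)))

/-- A projectively isolated subshift. -/
def ProjIsolated (G : Type) [Group G] (A : Type) (X : Set (G → A)) : Prop :=
  ∃ (B : Type) (_ : Fintype B) (_ : Nontrivial B) (Y : Set (G → B))
    (F D : Finset G) (f : (D → B) → A),
    IsSubshift G B Y ∧
    slidingBlock D f '' Y = X ∧
    ∀ Z : Set (G → B), IsSubshift G B Z → patterns F Z = patterns F Y →
      slidingBlock D f '' Z = X

/-- An isolated subshift: an SFT `X` such that for some finite `F ⊆ G` no proper
subshift has the same `F`-patterns as `X`. -/
def IsIsolated (G : Type) [Group G] (A : Type) (X : Set (G → A)) : Prop :=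
  IsSFT G A X ∧ ∃ F : Finset G, ∀ Y : Set (G → A),
    IsSubshift G A Y → Y ⊂ X → patterns F Y ≠ patterns F X

/-- A strongly projectively isolated subshift: a continuous `G`-equivariant image of an
isolated subshift. -/
def StronglyProjIsolated (G : Type) [Group G] (A : Type) (X : Set (G → A)) : Prop :=
  ∃ (B : Type) (_ : Fintype B) (_ : Nontrivial B) (Y : Set (G → B))
    (ψ : (G → B) → (G → A)),
    IsSubshift G B Y ∧ IsIsolated G B Y ∧
    ContinuousOnD ψ Y ∧ EquivariantOn ψ Y ∧ ψ '' Y = X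

/-- Shadowing (the pseudo-orbit tracing property) of an action `act` of `G`,
with respect to a distance function `d`. -/
def HasShadowing {G X : Type} [Group G] (d : X → X → ℝ) (act : G → X → X) : Prop :=
  ∀ ε : ℝ, 0 < ε → ∃ (δ : ℝ) (S : Finset G), 0 < δ ∧
    ∀ x : G → X, (∀ g : G, ∀ s ∈ S, d (act s (x g)) (x (s * g)) < δ) →
      ∃ y : X, ∀ g : G, d (x g) (act g y) < ε

/-- A finite partition of the whole space into nonempty clopen sets. -/
def IsClopenPartition {X : Type} [TopologicalSpace X] (parts : Finset (Set X)) : Prop :=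
  (∀ P ∈ parts, IsClopen P ∧ P.Nonempty) ∧
  (∀ P ∈ parts, ∀ Q ∈ parts, P ≠ Q → Disjoint P Q) ∧
  (⋃ P ∈ parts, P) = Set.univ

/-- A finite partition of a subshift `X` into nonempty subsets that are clopen in `X`. -/
def IsClopenPartitionIn {G A : Type} (X : Set (G → A)) (parts : Finset (Set (G → A))) : Prop :=
  (letI : TopologicalSpace A := ⊥;
    ∀ P ∈ parts, P.Nonempty ∧ P ⊆ X ∧ IsClopen (Subtype.val ⁻¹' P : Set X)) ∧
  (∀ P ∈ parts, ∀ Q ∈ parts, P ≠ Q → Disjoint P Q) ∧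
  (⋃ P ∈ parts, P) = X

/-- `X` is `fam`-minimal: no nonempty proper subshift of `X` meets every member of `fam`. -/
def AMinimal {G A : Type} [Group G] (X : Set (G → A)) (fam : Set (Set (G → A))) : Prop :=
  ¬ ∃ Y : Set (G → A), IsSubshift G A Y ∧ Y.Nonempty ∧ Y ⊂ X ∧
    ∀ S ∈ fam, (Y ∩ S).Nonempty

/-- The free product of a subshift `V ⊆ B^G` and a subshift `W ⊆ B^H`, a subshift
of `B^(G∗H)`. -/
def freeProd {G H B : Type} [Group G] [Group H]
    (V : Set (G → B)) (W : Set (H → B)) : Set (Monoid.Coprod G H → B) :=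
  {x | ∀ g : Monoid.Coprod G H,
    (fun h : G => x (g * Monoid.Coprod.inl h)) ∈ V ∧
    (fun k : H => x (g * Monoid.Coprod.inr k)) ∈ W}

/-- A sequence of nested closed relations with total projections that eventually separates
points on both sides intersects in the graph of a homeomorphism. -/
theorem exists_homeomorph_of_relations {X Y : Type} [TopologicalSpace X] [TopologicalSpace Y]
    [CompactSpace X] [T2Space X] [CompactSpace Y] [T2Space Y] (R : ℕ → Set (X × Y))
    (hclosed : ∀ n, IsClosed (R n)) (hanti : Antitone R)
    (hleft : ∀ n x, ∃ y, (x, y) ∈ R n) (hright : ∀ n y, ∃ x, (x, y) ∈ R n)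
    (hinj : ∀ x x' y, (∀ n, (x, y) ∈ R n) → (∀ n, (x', y) ∈ R n) → x = x')
    (hfun : ∀ x y y', (∀ n, (x, y) ∈ R n) → (∀ n, (x, y') ∈ R n) → y = y') :
    ∃ φ : X ≃ₜ Y, ∀ x y, φ x = y ↔ ∀ n, (x, y) ∈ R n := by
  have hx : ∀ x, ∃ y, ∀ n, (x, y) ∈ R n := fun x => by
    have := IsCompact.nonempty_iInter_of_sequence_nonempty_isCompact_isClosed
      (fun n => {y | (x, y) ∈ R n}) (fun n y hy => hanti (Nat.le_succ n) hy) (fun n => hleft n x)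
      ((hclosed 0).preimage (by fun_prop)).isCompact (fun n => (hclosed n).preimage (by fun_prop))
    simpa [Set.Nonempty] using this
  have hy : ∀ y, ∃ x, ∀ n, (x, y) ∈ R n := fun y => by
    have := IsCompact.nonempty_iInter_of_sequence_nonempty_isCompact_isClosed
      (fun n => {x | (x, y) ∈ R n}) (fun n x hx => hanti (Nat.le_succ n) hx)
      (fun n => hright n y)
      ((hclosed 0).preimage (by fun_prop)).isCompact (fun n => (hclosed n).preimage (by fun_prop))
    simpa [Set.Nonempty] using this
  choose f hf using hx
  choose g hg using hy
  have hgraph : ∀ x y, f x = y ↔ ∀ n, (x, y) ∈ R n :=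
    fun x y => ⟨fun h => h ▸ hf x, fun h => hfun x _ _ (hf x) h⟩
  have hcont : Continuous f := by
    refine continuous_iff_isClosed.2 fun C hC => ?_
    have : f ⁻¹' C = Prod.fst '' ((⋂ n, R n) ∩ Prod.snd ⁻¹' C) := by
      ext x
      constructor
      · intro h
        exact ⟨(x, f x), ⟨by simpa using hf x, h⟩, rfl⟩
      · rintro ⟨⟨x', y⟩, ⟨h1, h2⟩, rfl⟩
        have : f x' = y := (hgraph _ _).2 (by simpa using h1)
        simpa [this] using h2
    rw [this]
    exact (((isClosed_iInter hclosed).inter (hC.preimage continuous_snd)).isCompact.image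
      continuous_fst).isClosed
  let e : X ≃ Y := ⟨f, g, fun x => hinj _ _ _ (hg (f x)) (hf x),
    fun y => hfun _ _ _ (hf (g y)) (hg y)⟩
  exact ⟨hcont.homeoOfEquivCompactToT2 (f := e), hgraph⟩

/-- Back-and-forth: a family of closed relations which can be refined to separate any clopen set
on either side yields a homeomorphism. -/
theorem exists_homeomorph_of_backAndForth {X Y : Type} [TopologicalSpace X] [TopologicalSpace Y]
    [CompactSpace X] [T2Space X] [CompactSpace Y] [T2Space Y]
    [TotallyDisconnectedSpace X] [TotallyDisconnectedSpace Y]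
    [SecondCountableTopology X] [SecondCountableTopology Y] (𝓡 : Set (Set (X × Y)))
    (R₀ : Set (X × Y)) (hR₀ : R₀ ∈ 𝓡)
    (hclosed : ∀ R ∈ 𝓡, IsClosed R)
    (hleft : ∀ R ∈ 𝓡, ∀ x, ∃ y, (x, y) ∈ R) (hright : ∀ R ∈ 𝓡, ∀ y, ∃ x, (x, y) ∈ R)
    (hX : ∀ R ∈ 𝓡, ∀ K : Set X, IsClopen K → ∃ R' ∈ 𝓡, R' ⊆ R ∧
      ∀ x x' y, (x, y) ∈ R' → (x', y) ∈ R' → x ∈ K → x' ∈ K)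
    (hY : ∀ R ∈ 𝓡, ∀ K : Set Y, IsClopen K → ∃ R' ∈ 𝓡, R' ⊆ R ∧
      ∀ x y y', (x, y) ∈ R' → (x, y') ∈ R' → y ∈ K → y' ∈ K) :
    ∃ (φ : X ≃ₜ Y) (R : ℕ → Set (X × Y)), (∀ n, R n ∈ 𝓡) ∧ R 0 = R₀ ∧
      ∀ x y, φ x = y ↔ ∀ n, (x, y) ∈ R n := by
  have : Countable (TopologicalSpace.Clopens X) :=
    TopologicalSpace.Clopens.countable_iff_secondCountable.2 inferInstance
  have : Countable (TopologicalSpace.Clopens Y) :=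
    TopologicalSpace.Clopens.countable_iff_secondCountable.2 inferInstance
  obtain ⟨K, hK⟩ := exists_surjective_nat (TopologicalSpace.Clopens X)
  obtain ⟨K', hK'⟩ := exists_surjective_nat (TopologicalSpace.Clopens Y)
  have step : ∀ (n : ℕ) (R : 𝓡), ∃ R' : 𝓡, R'.1 ⊆ R.1 ∧
      (∀ x x' y, (x, y) ∈ R'.1 → (x', y) ∈ R'.1 → x ∈ K n → x' ∈ K n) ∧
      (∀ x y y', (x, y) ∈ R'.1 → (x, y') ∈ R'.1 → y ∈ K' n → y' ∈ K' n) := by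
    rintro n ⟨R, hR⟩
    obtain ⟨R₁, h₁, hs₁, hk₁⟩ := hX R hR (K n) (K n).isClopen
    obtain ⟨R₂, h₂, hs₂, hk₂⟩ := hY R₁ h₁ (K' n) (K' n).isClopen
    exact ⟨⟨R₂, h₂⟩, hs₂.trans hs₁, fun x x' y h h' => hk₁ x x' y (hs₂ h) (hs₂ h'), hk₂⟩
  choose next hnext using step
  let R : ℕ → 𝓡 := fun n => Nat.rec ⟨R₀, hR₀⟩ next n
  have hR : ∀ n, R (n + 1) = next n (R n) := fun n => rfl
  obtain ⟨φ, hφ⟩ := exists_homeomorph_of_relations (fun n => (R n).1)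
    (fun n => hclosed _ (R n).2)
    (antitone_nat_of_succ_le fun n => by rw [hR]; exact (hnext n (R n)).1)
    (fun n => hleft _ (R n).2) (fun n => hright _ (R n).2)
    (fun x x' y h h' => by
      by_contra hne
      obtain ⟨U, hU, hxU, hxU'⟩ := exists_isClopen_of_totally_separated hne
      obtain ⟨n, hn⟩ := hK ⟨U, hU⟩
      refine hxU' ?_
      have := (hnext n (R n)).2.1 x x' y (hR n ▸ h (n + 1)) (hR n ▸ h' (n + 1))
      rw [hn] at this
      exact this hxU)
    (fun x y y' h h' => by
      by_contra hne
      obtain ⟨U, hU, hxU, hxU'⟩ := exists_isClopen_of_totally_separated hne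
      obtain ⟨n, hn⟩ := hK' ⟨U, hU⟩
      refine hxU' ?_
      have := (hnext n (R n)).2.2 x y y' (hR n ▸ h (n + 1)) (hR n ▸ h' (n + 1))
      rw [hn] at this
      exact this hxU)
  exact ⟨φ, fun n => (R n).1, fun n => (R n).2, rfl, hφ⟩

theorem exists_isClopen_splitting {X : Type} [TopologicalSpace X] [TotallySeparatedSpace X]
    [PerfectSpace X] {U : Set X} (hU : IsOpen U) (hne : U.Nonempty) :
    ∃ D : Set X, IsClopen D ∧ (U ∩ D).Nonempty ∧ (U \ D).Nonempty := by
  obtain ⟨x, hx⟩ := hne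
  obtain ⟨y, ⟨hyU, -⟩, hyx⟩ := preperfect_iff_nhds.1 (PerfectSpace.univ_preperfect (α := X)) x
    trivial U (hU.mem_nhds hx)
  obtain ⟨D, hD, hyD, hxD⟩ := exists_isClopen_of_totally_separated hyx
  exact ⟨D, hD, ⟨y, hyU, hyD⟩, ⟨x, hx, hxD⟩⟩

theorem IsLocallyConstant.isClosed_eq {X Y Q : Type} [TopologicalSpace X] [TopologicalSpace Y]
    {p : X → Q} {q : Y → Q} (hp : IsLocallyConstant p) (hq : IsLocallyConstant q) :
    IsClosed {z : X × Y | p z.1 = q z.2} := by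
  have hpq : IsLocallyConstant fun z : X × Y => (p z.1, q z.2) :=
    (hp.comp_continuous continuous_fst).prodMk (hq.comp_continuous continuous_snd)
  exact isOpen_compl_iff.1 (hpq {w | w.1 ≠ w.2})

/-- A refinement of a clopen partition can be copied along a matching clopen partition of a
perfect space. -/
theorem exists_matching_refinement {X Y Q : Type} [TopologicalSpace Y] [TotallySeparatedSpace Y]
    [PerfectSpace Y] {p : X → Q} {q : Y → Q} (hq : IsLocallyConstant q)
    (hpq : Set.range p = Set.range q) (K : X → Prop) :
    ∃ q' : Y → Q × Prop, IsLocallyConstant q' ∧ (∀ y, (q' y).1 = q y) ∧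
      Set.range (fun x => (p x, K x)) = Set.range q' := by
  have key : ∀ a : Q, ∃ D : Set Y, IsClopen D ∧
      ((∃ y, q y = a ∧ y ∈ D) ↔ ∃ x, p x = a ∧ K x) ∧
      ((∃ y, q y = a ∧ y ∉ D) ↔ ∃ x, p x = a ∧ ¬ K x) := by
    intro a
    have hex : (∃ x, p x = a) ↔ ∃ y, q y = a := by
      simpa [Set.mem_range] using Set.ext_iff.1 hpq a
    by_cases h1 : ∃ x, p x = a ∧ K x
    · by_cases h2 : ∃ x, p x = a ∧ ¬ K x
      · obtain ⟨D, hD, ⟨y, hy, hyD⟩, ⟨z, hz, hzD⟩⟩ := exists_isClopen_splitting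
          (hq.isOpen_fiber a) (hex.1 ⟨h1.choose, h1.choose_spec.1⟩)
        exact ⟨D, hD, ⟨fun _ => h1, fun _ => ⟨y, hy, hyD⟩⟩, ⟨fun _ => h2, fun _ => ⟨z, hz, hzD⟩⟩⟩
      · refine ⟨Set.univ, isClopen_univ, ?_, ?_⟩
        · obtain ⟨y, hy⟩ := hex.1 ⟨h1.choose, h1.choose_spec.1⟩
          exact ⟨fun _ => h1, fun _ => ⟨y, hy, trivial⟩⟩
        · simpa using h2
    · refine ⟨∅, isClopen_empty, by simpa using h1, ?_⟩
      constructor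
      · rintro ⟨y, hy, -⟩
        obtain ⟨x, hx⟩ := hex.2 ⟨y, hy⟩
        exact ⟨x, hx, fun h => h1 ⟨x, hx, h⟩⟩
      · rintro ⟨x, hx, -⟩
        obtain ⟨y, hy⟩ := hex.1 ⟨x, hx⟩
        exact ⟨y, hy, by simp⟩
  choose D hD hD1 hD2 using key
  refine ⟨fun y => (q y, y ∈ D (q y)), ?_, fun y => rfl, ?_⟩
  · refine hq.prodMk ?_
    rw [IsLocallyConstant.iff_eventually_eq]
    intro y
    have h1 := (IsLocallyConstant.iff_eventually_eq q).1 hq y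
    by_cases hy : y ∈ D (q y)
    · filter_upwards [h1, (hD (q y)).isOpen.mem_nhds hy] with z hz hz'
      rw [hz]; exact propext ⟨fun _ => hy, fun _ => hz'⟩
    · filter_upwards [h1, (hD (q y)).compl.isOpen.mem_nhds hy] with z hz hz'
      rw [hz]; exact propext ⟨fun h => absurd h hz', fun h => absurd h hy⟩
  · ext ⟨a, k⟩
    simp only [Set.mem_range, Prod.mk.injEq]
    by_cases hk : k
    · have hk' : k = True := by simpa using hk
      subst hk'
      simp only [eq_iff_iff, iff_true]
      rw [← hD1 a]
      constructor <;> (rintro ⟨y, rfl, hy⟩; exact ⟨y, rfl, hy⟩)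
    · have hk' : k = False := by simpa using hk
      subst hk'
      simp only [eq_iff_iff, iff_false]
      rw [← hD2 a]
      constructor <;> (rintro ⟨y, rfl, hy⟩; exact ⟨y, rfl, hy⟩)

theorem IsClopen.isLocallyConstant_mem {X : Type} [TopologicalSpace X] {K : Set X}
    (hK : IsClopen K) : IsLocallyConstant fun x => x ∈ K := by
  rw [IsLocallyConstant.iff_eventually_eq]
  intro x
  by_cases hx : x ∈ K
  · filter_upwards [hK.isOpen.mem_nhds hx] with z hz
    exact propext ⟨fun _ => hx, fun _ => hz⟩
  · filter_upwards [hK.compl.isOpen.mem_nhds hx] with z hz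
    exact propext ⟨fun h => absurd h hz, fun h => absurd h hx⟩

/-- Two perfect compact metrizable zero-dimensional spaces with clopen partitions indexed by the
same set are homeomorphic, by a homeomorphism matching the partitions. -/
theorem exists_homeomorph_comp_eq {X Y Q : Type} [TopologicalSpace X] [TopologicalSpace Y]
    [CompactSpace X] [T2Space X] [CompactSpace Y] [T2Space Y]
    [TotallyDisconnectedSpace X] [TotallyDisconnectedSpace Y]
    [SecondCountableTopology X] [SecondCountableTopology Y] [PerfectSpace X] [PerfectSpace Y]
    {p : X → Q} {q : Y → Q} (hp : IsLocallyConstant p) (hq : IsLocallyConstant q)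
    (hpq : Set.range p = Set.range q) : ∃ φ : X ≃ₜ Y, ∀ x, q (φ x) = p x := by
  obtain ⟨φ, R, hR, hR0, hφ⟩ := exists_homeomorph_of_backAndForth (X := X) (Y := Y)
    {R | ∃ (Q' : Type) (f : X → Q') (h : Y → Q'), IsLocallyConstant f ∧ IsLocallyConstant h ∧
      Set.range f = Set.range h ∧ R = {z | f z.1 = h z.2}}
    {z | p z.1 = q z.2} ⟨Q, p, q, hp, hq, hpq, rfl⟩
    (by rintro _ ⟨Q', f, h, hf, hh, -, rfl⟩; exact hf.isClosed_eq hh)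
    (by
      rintro _ ⟨Q', f, h, hf, hh, hfh, rfl⟩ x
      obtain ⟨y, hy⟩ : f x ∈ Set.range h := hfh ▸ ⟨x, rfl⟩
      exact ⟨y, hy.symm⟩)
    (by
      rintro _ ⟨Q', f, h, hf, hh, hfh, rfl⟩ y
      obtain ⟨x, hx⟩ : h y ∈ Set.range f := hfh ▸ ⟨y, rfl⟩
      exact ⟨x, hx⟩)
    (by
      rintro _ ⟨Q', f, h, hf, hh, hfh, rfl⟩ K hK
      obtain ⟨h', hh', hh1, hrange⟩ := exists_matching_refinement hh hfh (· ∈ K)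
      refine ⟨_, ⟨_, _, h', hf.prodMk hK.isLocallyConstant_mem, hh', hrange, rfl⟩, ?_, ?_⟩
      · rintro ⟨x, y⟩ hxy
        have : (f x, x ∈ K) = h' y := hxy
        change f x = h y
        rw [← hh1 y, ← this]
      · intro x x' y hxy hxy' hx
        have h1 : (f x, x ∈ K) = h' y := hxy
        have h2 : (f x', x' ∈ K) = h' y := hxy'
        rw [← h2] at h1
        exact (Prod.mk.inj h1).2.mp hx)
    (by
      rintro _ ⟨Q', f, h, hf, hh, hfh, rfl⟩ K hK
      obtain ⟨f', hf', hf1, hrange⟩ := exists_matching_refinement hf hfh.symm (· ∈ K)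
      refine ⟨_, ⟨_, f', _, hf', hh.prodMk hK.isLocallyConstant_mem, hrange.symm, rfl⟩, ?_, ?_⟩
      · rintro ⟨x, y⟩ hxy
        have : f' x = (h y, y ∈ K) := hxy
        change f x = h y
        rw [← hf1 x, this]
      · intro x y y' hxy hxy' hy
        have h1 : f' x = (h y, y ∈ K) := hxy
        have h2 : f' x = (h y', y' ∈ K) := hxy'
        rw [h2] at h1
        exact (Prod.mk.inj h1).2.mpr hy)
  refine ⟨φ, fun x => ?_⟩
  have := (hφ x (φ x)).1 rfl 0
  rw [hR0] at this
  exact this.symm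

section Coding

variable {G : Type} [Group G]

/-- The symbolic coding `x ↦ (h ↦ f (h⁻¹ · x))` of an action along `f`. -/
def code {B : Type} (α : ActSpace G) (f : Cantor → B) (x : Cantor) : G → B :=
  fun h => f (α.1 h⁻¹ x)

theorem act_one (α : ActSpace G) (x : Cantor) : α.1 1 x = x := by
  rw [α.2.1]; rfl

theorem act_mul (α : ActSpace G) (g h : G) (x : Cantor) : α.1 (g * h) x = α.1 g (α.1 h x) := by
  rw [α.2.2]; rfl

theorem code_one {B : Type} (α : ActSpace G) (f : Cantor → B) (x : Cantor) :
    code α f x 1 = f x := by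
  simp [code, act_one]

theorem code_act {B : Type} (α : ActSpace G) (f : Cantor → B) (g : G) (x : Cantor) :
    code α f (α.1 g x) = shift g (code α f x) := by
  funext h
  simp [code, shift, ← act_mul]

theorem code_comp {B B' : Type} (α : ActSpace G) (f : Cantor → B) (l : B → B') (x : Cantor) :
    code α (l ∘ f) x = l ∘ code α f x := rfl

theorem isLocallyConstant_code {B : Type} (α : ActSpace G) {f : Cantor → B}
    (hf : IsLocallyConstant f) (h : G) : IsLocallyConstant fun x => code α f x h :=
  hf.comp_continuous (α.1 h⁻¹).continuous

theorem isLocallyConstant_pi {X ι B : Type} [TopologicalSpace X] [Finite ι] {f : X → ι → B}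
    (hf : ∀ i, IsLocallyConstant fun x => f x i) : IsLocallyConstant f := by
  rw [IsLocallyConstant.iff_eventually_eq]
  intro x
  have := fun i => (IsLocallyConstant.iff_eventually_eq _).1 (hf i) x
  filter_upwards [Filter.eventually_all.2 this] with y hy
  exact funext hy

theorem continuous_code {B : Type} [TopologicalSpace B] (α : ActSpace G) {f : Cantor → B}
    (hf : IsLocallyConstant f) : Continuous (code α f) :=
  continuous_pi fun h => (isLocallyConstant_code α hf h).continuous

theorem isSubshift_range_code {B : Type} (α : ActSpace G) {f : Cantor → B}
    (hf : IsLocallyConstant f) : IsSubshift G B (Set.range (code α f)) := by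
  constructor
  · let _ : TopologicalSpace B := ⊥
    have : DiscreteTopology B := ⟨rfl⟩
    exact (isCompact_range (continuous_code α hf)).isClosed
  · rintro g _ ⟨x, rfl⟩
    exact ⟨_, code_act α f g x⟩

theorem shift_shift {B : Type} (g h : G) (x : G → B) : shift g (shift h x) = shift (g * h) x := by
  funext k; simp [shift, mul_assoc]

theorem shift_one {B : Type} (x : G → B) : shift 1 x = x := by
  funext k; simp [shift]

/-- Two actions with the same coding along `f` in a finite window have the same patterns. -/
theorem isIsolated_range_code_local {B : Type} {Y : Set (G → B)} (hY : IsIsolated G B Y) :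
    ∃ S : Finset G, ∀ (α β : ActSpace G) (f : Cantor → B), IsLocallyConstant f →
      (∀ s ∈ S, ∀ x, f (β.1 s x) = f (α.1 s x)) →
      Set.range (code α f) = Y → Set.range (code β f) = Y := by
  classical
  obtain ⟨⟨E, 𝔽, hE⟩, F, hF⟩ := hY
  refine ⟨(E ∪ F).image (·⁻¹), fun α β f hf hαβ hα => ?_⟩
  have hcode : ∀ x, ∀ e ∈ E ∪ F, code β f x e = code α f x e := fun x e he =>
    hαβ e⁻¹ (Finset.mem_image_of_mem _ he) x
  have hsub : Set.range (code β f) ⊆ Y := by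
    rintro _ ⟨x, rfl⟩
    rw [hE]
    intro g
    have h1 : code α f (β.1 g x) ∈ Y := hα ▸ ⟨_, rfl⟩
    have h2 := (hE _).1 h1 1
    rw [shift_one] at h2
    rw [← code_act]
    convert h2 using 2 with e
    exact hcode _ e (Finset.mem_union_left _ e.2)
  by_contra hne
  refine hF _ (isSubshift_range_code β hf) (lt_of_le_of_ne hsub hne) ?_
  rw [← hα]
  ext p
  constructor
  · rintro ⟨_, ⟨x, rfl⟩, rfl⟩
    exact ⟨_, ⟨x, rfl⟩, funext fun e => (hcode x e (Finset.mem_union_right _ e.2)).symm⟩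
  · rintro ⟨_, ⟨x, rfl⟩, rfl⟩
    exact ⟨_, ⟨x, rfl⟩, funext fun e => hcode x e (Finset.mem_union_right _ e.2)⟩

theorem isOpen_setOf_agree {B : Type} (α : ActSpace G) {f : Cantor → B}
    (hf : IsLocallyConstant f) (S : Finset G) :
    IsOpen {β : ActSpace G | ∀ s ∈ S, ∀ x, f (β.1 s x) = f (α.1 s x)} := by
  have : {β : ActSpace G | ∀ s ∈ S, ∀ x, f (β.1 s x) = f (α.1 s x)} =
      ⋂ s ∈ S, {β : ActSpace G | ∀ x, f (β.1 s x) = f (α.1 s x)} := by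
    ext; simp
  rw [this]
  refine isOpen_biInter_finset fun s _ => ?_
  let h : C(Cantor, Cantor) := α.1 s
  have hfin : (Set.range f).Finite := hf.range_finite
  have h2 : {β : ActSpace G | ∀ x, f (β.1 s x) = f (α.1 s x)} =
      ⋂ b ∈ Set.range f, {β : ActSpace G | Set.MapsTo (β.1 s) (h ⁻¹' (f ⁻¹' {b})) (f ⁻¹' {b})} := by
    ext β
    simp only [Set.mem_iInter, Set.mem_ofPred_eq]
    constructor
    · rintro H b - x hx
      exact (H x).trans hx
    · intro H x
      exact H (f (h x)) ⟨_, rfl⟩ (x := x) rfl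
  rw [h2]
  refine hfin.isOpen_biInter fun b _ => ?_
  have hK : IsCompact (h ⁻¹' (f ⁻¹' {b})) :=
    ((hf.isClosed_fiber b).preimage h.continuous).isCompact
  exact (ContinuousMap.isOpen_setOfPred_mapsTo hK (hf.isOpen_fiber b)).preimage
    (f := fun β : ActSpace G => β.1 s) ((continuous_apply s).comp continuous_subtype_val)

theorem exists_agree_subset_of_mem_nhds {α : ActSpace G} {U : Set (ActSpace G)} (hU : U ∈ 𝓝 α) :
    ∃ (B : Type) (_ : Finite B) (f : Cantor → B) (S : Finset G), IsLocallyConstant f ∧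
      ∀ β : ActSpace G, (∀ s ∈ S, ∀ x, f (β.1 s x) = f (α.1 s x)) → β ∈ U := by
  classical
  let P : (TopologicalSpace.Clopens Cantor × G) → Set (ActSpace G) :=
    fun k => {β | ∀ x, β.1 k.2 x ∈ k.1 ↔ α.1 k.2 x ∈ k.1}
  let l : Filter (ActSpace G) := ⨅ k, Filter.principal (P k)
  have hl : l ≤ 𝓝 α := by
    have : Filter.Tendsto id l (𝓝 α) := by
      refine tendsto_subtype_rng.2 (tendsto_pi_nhds.2 fun g => ?_)
      refine ContinuousMap.tendsto_nhds_compactOpen.2 fun K hK V hV hKV => ?_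
      obtain ⟨W, hW, hKW, hWV⟩ := exists_clopen_of_closed_subset_open
        (hK.image (α.1 g).continuous).isClosed hV (Set.mapsTo_iff_image_subset.1 hKV)
      have : P (⟨W, hW⟩, g) ∈ l :=
        Filter.mem_iInf_of_mem (⟨W, hW⟩, g) (Filter.mem_principal_self _)
      filter_upwards [this] with β hβ x hx
      exact hWV ((hβ x).2 (hKW ⟨x, hx, rfl⟩))
    exact this
  obtain ⟨t, ht, htU⟩ := (Filter.hasBasis_iInf_principal_finite P).mem_iff.1 (hl hU)
  have := ht.to_subtype
  refine ⟨t → Prop, inferInstance, fun x k => x ∈ k.1.1, ht.toFinset.image Prod.snd,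
    isLocallyConstant_pi fun k => k.1.1.isClopen.isLocallyConstant_mem, fun β hβ => htU ?_⟩
  simp only [Set.mem_iInter]
  intro k hk x
  have := congrFun (hβ k.2 (Finset.mem_image_of_mem _ (ht.mem_toFinset.2 hk)) x) ⟨k, hk⟩
  exact iff_of_eq this

theorem isOpen_of_agree {U : Set (ActSpace G)}
    (hU : ∀ α ∈ U, ∃ (B : Type) (f : Cantor → B) (S : Finset G), IsLocallyConstant f ∧
      ∀ β : ActSpace G, (∀ s ∈ S, ∀ x, f (β.1 s x) = f (α.1 s x)) → β ∈ U) : IsOpen U := by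
  rw [isOpen_iff_mem_nhds]
  intro α hα
  obtain ⟨B, f, S, hf, h⟩ := hU α hα
  exact Filter.mem_of_superset ((isOpen_setOf_agree α hf S).mem_nhds fun _ _ _ => rfl) h

instance : PerfectSpace Cantor := by
  rw [perfectSpace_iff_forall_not_isolated]
  intro x
  refine Filter.neBot_iff.2 fun h => ?_
  have hopen : IsOpen ({x} : Set Cantor) := isOpen_singleton_iff_punctured_nhds x |>.2 h
  obtain ⟨I, u, hu, hsub⟩ := isOpen_pi_iff.1 hopen x rfl
  obtain ⟨n, hn⟩ := Infinite.exists_notMem_finset I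
  have : Function.update x n (!x n) ∈ ({x} : Set Cantor) := hsub fun i hi => by
    have hne : i ≠ n := fun h => hn (h ▸ hi)
    rw [Function.update_of_ne hne]
    exact (hu i hi).2
  have := congrFun this n
  simp at this

instance {Z : Type} [TopologicalSpace Z] : PerfectSpace (Z × Cantor) := by
  rw [perfectSpace_iff_forall_not_isolated]
  rintro ⟨z, x⟩
  have hx := perfectSpace_iff_forall_not_isolated.1 (inferInstanceAs (PerfectSpace Cantor)) x
  have : Filter.Tendsto (fun y => (z, y)) (𝓝[≠] x) (𝓝[≠] (z, x)) := by
    refine tendsto_nhdsWithin_iff.2 ⟨?_, ?_⟩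
    · exact ((Continuous.prodMk_right z).tendsto x).mono_left nhdsWithin_le_nhds
    · filter_upwards [self_mem_nhdsWithin] with y hy h
      exact hy (Prod.mk.inj h).2
  exact this.neBot

/-- A subshift whose letter-to-letter image has the same patterns as a given coding is realized as
a coding of a nearby action. -/
theorem exists_action_realizing [Countable G] (α : ActSpace G) {B B₀ : Type} [Finite B]
    {f : Cantor → B₀} (hf : IsLocallyConstant f) (S F : Finset G) (h1 : 1 ∈ F)
    (hS : ∀ s ∈ S, s⁻¹ ∈ F) {Z : Set (G → B)} (hZ : IsSubshift G B Z) (l : B → B₀)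
    (hpat : patterns F ((fun y => l ∘ y) '' Z) = patterns F (Set.range (code α f))) :
    ∃ (β : ActSpace G) (k : Cantor → B), IsLocallyConstant k ∧ Set.range (code β k) = Z ∧
      l ∘ k = f ∧ ∀ s ∈ S, ∀ x, f (β.1 s x) = f (α.1 s x) := by
  let _ : TopologicalSpace B := ⊥
  have : DiscreteTopology B := ⟨rfl⟩
  have hcl : IsClosed Z := hZ.1
  have : CompactSpace Z := isCompact_iff_compactSpace.1 hcl.isCompact
  let p : Z × Cantor → F → B₀ := fun t s => l (t.1.1 s)
  let q : Cantor → F → B₀ := fun x s => code α f x s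
  have hp : IsLocallyConstant p := isLocallyConstant_pi fun s =>
    (IsLocallyConstant.of_discrete l).comp_continuous
      ((continuous_apply (s : G)).comp (continuous_subtype_val.comp continuous_fst))
  have hq : IsLocallyConstant q := isLocallyConstant_pi fun s => isLocallyConstant_code α hf s
  have hpq : Set.range p = Set.range q := by
    ext w
    have := Set.ext_iff.1 hpat w
    constructor
    · rintro ⟨⟨z, c⟩, rfl⟩
      obtain ⟨_, ⟨x, rfl⟩, hx⟩ := this.1 ⟨_, ⟨z.1, z.2, rfl⟩, rfl⟩
      exact ⟨x, hx⟩
    · rintro ⟨x, rfl⟩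
      obtain ⟨_, ⟨z, hz, rfl⟩, hx⟩ := this.2 ⟨_, ⟨x, rfl⟩, rfl⟩
      exact ⟨(⟨z, hz⟩, x), hx⟩
  obtain ⟨φ, hφ⟩ := exists_homeomorph_comp_eq hp hq hpq
  let act : G → Z × Cantor → Z × Cantor := fun g t => (⟨shift g t.1.1, hZ.2 g _ t.1.2⟩, t.2)
  have hact : ∀ g, Continuous (act g) := fun g => by
    refine Continuous.prodMk (Continuous.subtype_mk ?_ _) continuous_snd
    exact continuous_pi fun h => (continuous_apply (g⁻¹ * h)).comp
      (continuous_subtype_val.comp continuous_fst)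
  let β : ActSpace G := ⟨fun g => ⟨fun x => φ (act g (φ.symm x)), by
      have := hact g; fun_prop⟩, by
    refine ⟨?_, fun g h => ?_⟩
    · ext1 x
      simp [act, shift_one]
    · ext1 x
      simp [act, shift_shift]⟩
  have hβ : ∀ g x, φ.symm (β.1 g x) = act g (φ.symm x) := fun g x => φ.symm_apply_apply _
  have hcode : ∀ x, code β (fun x => (φ.symm x).1.1 1) x = (φ.symm x).1.1 := fun x => by
    funext h
    simp only [code, hβ]
    simp [act, shift]
  have hqφ : ∀ x, q x = p (φ.symm x) := fun x => by rw [← hφ, φ.apply_symm_apply]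
  have hf1 : ∀ x, f x = l ((φ.symm x).1.1 1) := fun x => by
    have := congrFun (hqφ x) ⟨1, h1⟩
    simpa [q, p, code_one] using this
  refine ⟨β, fun x => (φ.symm x).1.1 1, ?_, ?_, ?_, ?_⟩
  · exact (IsLocallyConstant.iff_continuous _).2 ((continuous_apply (1 : G)).comp
      (continuous_subtype_val.comp (continuous_fst.comp φ.symm.continuous)))
  · ext z
    constructor
    · rintro ⟨x, rfl⟩
      rw [hcode]
      exact Subtype.property _
    · intro hz
      refine ⟨φ (⟨z, hz⟩, fun _ => false), ?_⟩
      rw [hcode, φ.symm_apply_apply]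
  · funext x
    exact (hf1 x).symm
  · intro s hs x
    have := congrFun (hqφ x) ⟨s⁻¹, hS s hs⟩
    simp only [q, p, code, inv_inv] at this
    rw [this, hf1, hβ]
    simp [act, shift]

end Coding

section Rokhlin

variable {G : Type} [Group G]

/-- Density of strongly projectively isolated subshifts, with letter-to-letter factor maps. -/
def IsolatedDense (G : Type) [Group G] : Prop :=
  ∀ (B : Type) [Finite B] [Nonempty B] (X : Set (G → B)), IsSubshift G B X → ∀ F : Finset G,
    ∃ (m : ℕ) (Y : Set (G → Fin (m + 2))) (l : Fin (m + 2) → B),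
      IsIsolated G (Fin (m + 2)) Y ∧ patterns F ((fun y => l ∘ y) '' Y) = patterns F X

theorem IsSFT.isSubshift {B : Type} {X : Set (G → B)} (hX : IsSFT G B X) : IsSubshift G B X := by
  obtain ⟨E, 𝔽, hE⟩ := hX
  constructor
  · let _ : TopologicalSpace B := ⊥
    have : DiscreteTopology B := ⟨rfl⟩
    have : X = ⋂ g : G, (fun (x : G → B) (e : E) => x (g⁻¹ * e)) ⁻¹' 𝔽 := by
      ext x
      simp only [hE, Set.mem_iInter]
      rfl
    rw [this]
    exact isClosed_iInter fun g => (isClosed_discrete 𝔽).preimage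
      (continuous_pi fun e => continuous_apply _)
  · intro g x hx
    rw [hE] at hx ⊢
    intro h
    rw [shift_shift]
    exact hx _

theorem countable_isSFT [Countable G] (B : Type) [Finite B] :
    Countable {X : Set (G → B) // IsSFT G B X} := by
  classical
  have h : ∀ X : {X : Set (G → B) // IsSFT G B X}, ∃ p : Σ E : Finset G, Set (E → B),
      ∀ x : G → B, x ∈ X.1 ↔ ∀ g : G, (fun e : p.1 => shift g x (e : G)) ∈ p.2 := by
    rintro ⟨X, E, 𝔽, hE⟩
    exact ⟨⟨E, 𝔽⟩, hE⟩
  choose p hp using h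
  have : Function.Injective p := fun X X' hXX' => by
    ext x
    rw [hp X, hp X', hXX']
  exact this.countable

instance countable_locallyConstant (m : ℕ) : Countable (LocallyConstant Cantor (Fin m)) := by
  have : Countable (TopologicalSpace.Clopens Cantor) :=
    TopologicalSpace.Clopens.countable_iff_secondCountable.2 inferInstance
  have h : Function.Injective fun (f : LocallyConstant Cantor (Fin m)) (i : Fin m) =>
      (⟨{x | f x = i}, f.isLocallyConstant.isClopen_fiber i⟩ : TopologicalSpace.Clopens Cantor) := by
    intro f f' hff'
    ext1 x
    have := congrArg (fun K : TopologicalSpace.Clopens Cantor => x ∈ K) (congrFun hff' (f x))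
    exact ((iff_of_eq this).1 rfl).symm
  exact h.countable

/-- The clopen partition `f` can be refined to one whose coding is an isolated subshift. -/
def RefinesIsolated {m : ℕ} (f : Cantor → Fin m) (α : ActSpace G) : Prop :=
  ∃ (m' : ℕ) (f' : Cantor → Fin m') (l : Fin m' → Fin m), IsLocallyConstant f' ∧ l ∘ f' = f ∧
    IsIsolated G (Fin m') (Set.range (code α f'))

/-- If the coding along `f` is the image of `Y` under the letter map `l`, then it lifts to a coding
with image `Y`. -/
def LiftsAlong {m m' : ℕ} (f : Cantor → Fin m) (l : Fin m' → Fin m) (Y : Set (G → Fin m'))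
    (α : ActSpace G) : Prop :=
  IsIsolated G (Fin m) ((fun y => l ∘ y) '' Y) →
    Set.range (code α f) = (fun y => l ∘ y) '' Y →
    ∃ f' : Cantor → Fin m', IsLocallyConstant f' ∧ l ∘ f' = f ∧ Set.range (code α f') = Y

theorem isOpen_refinesIsolated {m : ℕ} (f : Cantor → Fin m) :
    IsOpen {α : ActSpace G | RefinesIsolated f α} := by
  refine isOpen_of_agree ?_
  rintro α ⟨m', f', l, hf', hl, hiso⟩
  obtain ⟨S, hS⟩ := isIsolated_range_code_local hiso
  refine ⟨_, f', S, hf', fun β hβ => ⟨m', f', l, hf', hl, ?_⟩⟩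
  rw [hS α β f' hf' hβ rfl]
  exact hiso

theorem dense_refinesIsolated [Countable G] (hG : IsolatedDense G) {m : ℕ} {f : Cantor → Fin m}
    (hf : IsLocallyConstant f) : Dense {α : ActSpace G | RefinesIsolated f α} := by
  classical
  intro α
  rw [mem_closure_iff_nhds]
  intro U hU
  obtain ⟨B, _, f₀, S, hf₀, hB⟩ := exists_agree_subset_of_mem_nhds hU
  have : Nonempty (B × Fin m) := ⟨(f₀ fun _ => false, f fun _ => false)⟩
  obtain ⟨m', Y, l, hY, hpat⟩ := hG (B × Fin m) _ (isSubshift_range_code α (hf₀.prodMk hf))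
    (insert 1 (S.image (·⁻¹)))
  obtain ⟨β, k, hk, hr, hlk, hβ⟩ := exists_action_realizing α (hf₀.prodMk hf) S
    (insert 1 (S.image (·⁻¹))) (Finset.mem_insert_self _ _)
    (fun s hs => Finset.mem_insert_of_mem (Finset.mem_image_of_mem _ hs)) hY.1.isSubshift l hpat
  refine ⟨β, hB β fun s hs x => congrArg Prod.fst (hβ s hs x),
    _, k, Prod.snd ∘ l, hk, ?_, by rwa [hr]⟩
  rw [Function.comp_assoc, hlk]
  rfl

theorem isOpen_liftsAlong {m m' : ℕ} {f : Cantor → Fin m} (hf : IsLocallyConstant f)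
    (l : Fin m' → Fin m) {Y : Set (G → Fin m')} (hY : IsIsolated G (Fin m') Y) :
    IsOpen {α : ActSpace G | LiftsAlong f l Y α} := by
  refine isOpen_of_agree fun α hα => ?_
  by_cases h1 : IsIsolated G (Fin m) ((fun y => l ∘ y) '' Y)
  · by_cases h2 : Set.range (code α f) = (fun y => l ∘ y) '' Y
    · obtain ⟨f', hf', hl, hr⟩ := hα h1 h2
      obtain ⟨S, hS⟩ := isIsolated_range_code_local hY
      exact ⟨_, f', S, hf', fun β hβ _ _ => ⟨f', hf', hl, hS α β f' hf' hβ hr⟩⟩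
    · obtain ⟨S, hS⟩ := isIsolated_range_code_local h1
      exact ⟨_, f, S, hf, fun β hβ _ h =>
        absurd (hS β α f hf (fun s hs x => (hβ s hs x).symm) h) h2⟩
  · exact ⟨_, f, ∅, hf, fun β _ h => absurd h h1⟩

theorem dense_liftsAlong [Countable G] {m m' : ℕ} {f : Cantor → Fin m}
    (hf : IsLocallyConstant f) (l : Fin m' → Fin m) {Y : Set (G → Fin m')}
    (hY : IsSubshift G (Fin m') Y) :
    Dense {α : ActSpace G | LiftsAlong f l Y α} := by
  classical
  intro α
  rw [mem_closure_iff_nhds]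
  intro U hU
  by_cases h : Set.range (code α f) = (fun y => l ∘ y) '' Y
  swap
  · exact ⟨α, mem_of_mem_nhds hU, fun _ h' => absurd h' h⟩
  obtain ⟨B, _, f₀, S, hf₀, hB⟩ := exists_agree_subset_of_mem_nhds hU
  let f₁ : Cantor → B × Fin m := fun x => (f₀ x, f x)
  have hf₁ : IsLocallyConstant f₁ := hf₀.prodMk hf
  let Z : Set (G → (B × Fin m) × Fin m') :=
    {z | (fun g => (z g).1) ∈ Set.range (code α f₁) ∧ (fun g => (z g).2) ∈ Y ∧
      ∀ g, l (z g).2 = (z g).1.2}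
  have hZ : IsSubshift G _ Z := by
    constructor
    · have h1 := (isSubshift_range_code α hf₁).1
      have h2 := hY.1
      let _ : TopologicalSpace (B × Fin m) := ⊥
      have : DiscreteTopology (B × Fin m) := ⟨rfl⟩
      let _ : TopologicalSpace (Fin m') := ⊥
      have : DiscreteTopology (Fin m') := ⟨rfl⟩
      let _ : TopologicalSpace ((B × Fin m) × Fin m') := ⊥
      have : DiscreteTopology ((B × Fin m) × Fin m') := ⟨rfl⟩
      have e1 : IsClosed {z : G → (B × Fin m) × Fin m' |
          (fun g => (z g).1) ∈ Set.range (code α f₁)} :=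
        h1.preimage (f := fun (z : G → (B × Fin m) × Fin m') g => (z g).1)
          (continuous_pi fun g => continuous_of_discreteTopology.comp (continuous_apply g))
      have e2 : IsClosed {z : G → (B × Fin m) × Fin m' | (fun g => (z g).2) ∈ Y} :=
        h2.preimage (f := fun (z : G → (B × Fin m) × Fin m') g => (z g).2)
          (continuous_pi fun g => continuous_of_discreteTopology.comp (continuous_apply g))
      have e3 : IsClosed {z : G → (B × Fin m) × Fin m' | ∀ g, l (z g).2 = (z g).1.2} := by
        have : {z : G → (B × Fin m) × Fin m' | ∀ g, l (z g).2 = (z g).1.2} =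
            ⋂ g, (fun z : G → (B × Fin m) × Fin m' => z g) ⁻¹' {w | l w.2 = w.1.2} := by
          ext; simp
        rw [this]
        exact isClosed_iInter fun g => (isClosed_discrete _).preimage (continuous_apply g)
      exact e1.inter (e2.inter e3)
    · rintro g z ⟨h1, h2, h3⟩
      exact ⟨(isSubshift_range_code α hf₁).2 g _ h1, hY.2 g _ h2, fun k => h3 _⟩
  have hlift : (fun z => Prod.fst ∘ z) '' Z = Set.range (code α f₁) := by
    ext w
    constructor
    · rintro ⟨z, hz, rfl⟩
      exact hz.1
    · rintro ⟨x, rfl⟩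
      obtain ⟨y, hy, hyx⟩ : code α f x ∈ (fun y => l ∘ y) '' Y := h ▸ ⟨x, rfl⟩
      exact ⟨fun g => (code α f₁ x g, y g), ⟨⟨x, rfl⟩, hy, fun g => congrFun hyx g⟩, rfl⟩
  obtain ⟨β, k, hk, hr, hlk, hβ⟩ := exists_action_realizing α hf₁ S
    (insert 1 (S.image (·⁻¹))) (Finset.mem_insert_self _ _)
    (fun s hs => Finset.mem_insert_of_mem (Finset.mem_image_of_mem _ hs)) hZ Prod.fst
    (by rw [hlift])
  have hmem : ∀ x, code β k x ∈ Z := fun x => hr ▸ ⟨x, rfl⟩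
  refine ⟨β, hB β fun s hs x => congrArg Prod.fst (hβ s hs x), fun _ _ =>
    ⟨Prod.snd ∘ k, hk.comp _, ?_, ?_⟩⟩
  · funext x
    have h3 := (hmem x).2.2 1
    rw [code_one] at h3
    have h4 : (k x).1 = f₁ x := congrFun hlk x
    rw [h4] at h3
    exact h3
  · ext y
    constructor
    · rintro ⟨x, rfl⟩
      exact (hmem x).2.1
    · intro hy
      obtain ⟨x, hx⟩ : l ∘ y ∈ Set.range (code α f) := h ▸ ⟨y, hy, rfl⟩
      have hz : (fun g => (code α f₁ x g, y g)) ∈ Z :=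
        ⟨⟨x, rfl⟩, hy, fun g => (congrFun hx g).symm⟩
      rw [← hr] at hz
      obtain ⟨x', hx'⟩ := hz
      exact ⟨x', by rw [code_comp, hx']; rfl⟩

/-- The one-sided extension step in the back-and-forth between two generic actions. -/
theorem exists_extension {α β : ActSpace G} {m : ℕ} {f h : Cantor → Fin m}
    (hα : ∀ (m : ℕ) (f : Cantor → Fin m), IsLocallyConstant f → RefinesIsolated f α)
    (hβ : ∀ (m m' : ℕ) (f : Cantor → Fin m) (l : Fin m' → Fin m) (Y : Set (G → Fin m')),
      IsLocallyConstant f → IsIsolated G (Fin m') Y → LiftsAlong f l Y β)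
    (hf : IsLocallyConstant f) (hh : IsLocallyConstant h)
    (hiso : IsIsolated G (Fin m) (Set.range (code α f)))
    (hfh : Set.range (code α f) = Set.range (code β h)) {K : Set Cantor} (hK : IsClopen K) :
    ∃ (m' : ℕ) (f' h' : Cantor → Fin m') (l : Fin m' → Fin m), IsLocallyConstant f' ∧
      IsLocallyConstant h' ∧ l ∘ f' = f ∧ l ∘ h' = h ∧
      IsIsolated G (Fin m') (Set.range (code α f')) ∧
      Set.range (code α f') = Set.range (code β h') ∧
      ∀ x x', f' x = f' x' → x ∈ K → x' ∈ K := by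
  classical
  obtain ⟨N, ⟨e⟩⟩ := Finite.exists_equiv_fin (Fin m × Prop)
  obtain ⟨m', f', l, hf', hl, hiso'⟩ := hα N (fun x => e (f x, x ∈ K))
    ((hf.prodMk hK.isLocallyConstant_mem).comp e)
  have hl' : ∀ x, e.symm (l (f' x)) = (f x, x ∈ K) := fun x => by
    have := congrFun hl x
    simp only [Function.comp] at this
    rw [this, e.symm_apply_apply]
  have hff' : (fun i => (e.symm (l i)).1) ∘ f' = f := funext fun x => congrArg Prod.fst (hl' x)
  have himg : Set.range (code α f) =
      (fun y => (fun i => (e.symm (l i)).1) ∘ y) '' Set.range (code α f') := by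
    rw [← Set.range_comp]
    congr 1
    funext x
    rw [Function.comp_apply, ← code_comp, hff']
  obtain ⟨h', hh', hlh', hr⟩ := hβ m m' h (fun i => (e.symm (l i)).1) _ hh hiso'
    (himg ▸ hiso) (by rw [← hfh, himg])
  refine ⟨m', f', h', _, hf', hh', hff', hlh', hiso', hr.symm, fun x x' hxx' hx => ?_⟩
  have h1 := hl' x
  rw [hxx', hl' x'] at h1
  exact (Prod.mk.inj h1).2.mpr hx

theorem isIsolated_univ_fin_one : IsIsolated G (Fin 1) (Set.univ : Set (G → Fin 1)) := by
  refine ⟨⟨∅, Set.univ, by simp⟩, ∅, fun Y _ hYX h => ?_⟩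
  obtain ⟨-, hne⟩ := (Set.ssubset_iff_subset_ne).1 hYX
  refine hne (Set.eq_univ_of_forall fun x => ?_)
  obtain ⟨y, hy, -⟩ : (fun (f : (∅ : Finset G)) => x f) ∈ patterns ∅ Y :=
    h ▸ ⟨x, trivial, rfl⟩
  rwa [Subsingleton.elim x y]

/-- Any two generic actions are conjugate. -/
theorem mem_conjClass_of_generic {α β : ActSpace G}
    (hα : ∀ (m : ℕ) (f : Cantor → Fin m), IsLocallyConstant f → RefinesIsolated f α)
    (hα' : ∀ (m m' : ℕ) (f : Cantor → Fin m) (l : Fin m' → Fin m) (Y : Set (G → Fin m')),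
      IsLocallyConstant f → IsIsolated G (Fin m') Y → LiftsAlong f l Y α)
    (hβ : ∀ (m : ℕ) (f : Cantor → Fin m), IsLocallyConstant f → RefinesIsolated f β)
    (hβ' : ∀ (m m' : ℕ) (f : Cantor → Fin m) (l : Fin m' → Fin m) (Y : Set (G → Fin m')),
      IsLocallyConstant f → IsIsolated G (Fin m') Y → LiftsAlong f l Y β) :
    β ∈ conjClass α := by
  have hrefine : ∀ {m m' : ℕ} {f h : Cantor → Fin m} {f' h' : Cantor → Fin m'}
      {l : Fin m' → Fin m}, l ∘ f' = f → l ∘ h' = h →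
      {z : Cantor × Cantor | code α f' z.1 = code β h' z.2} ⊆
        {z | code α f z.1 = code β h z.2} := by
    rintro m m' _ _ f' h' l rfl rfl ⟨x, y⟩ hxy
    have hxy : code α f' x = code β h' y := hxy
    change code α (l ∘ f') x = code β (l ∘ h') y
    rw [code_comp, code_comp, hxy]
  obtain ⟨φ, R, hR, -, hφ⟩ := exists_homeomorph_of_backAndForth (X := Cantor) (Y := Cantor)
    {R | ∃ (m : ℕ) (f h : Cantor → Fin m), IsLocallyConstant f ∧ IsLocallyConstant h ∧
      IsIsolated G (Fin m) (Set.range (code α f)) ∧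
      Set.range (code α f) = Set.range (code β h) ∧ R = {z | code α f z.1 = code β h z.2}}
    {z | code α (fun _ => (0 : Fin 1)) z.1 = code β (fun _ => (0 : Fin 1)) z.2}
    (by
      have : ∀ γ : ActSpace G, Set.range (code γ fun _ => (0 : Fin 1)) = Set.univ := fun γ =>
        Set.eq_univ_of_forall fun x => ⟨fun _ => false, Subsingleton.elim _ _⟩
      refine ⟨1, fun _ => 0, fun _ => 0, IsLocallyConstant.const _, IsLocallyConstant.const _, ?_, ?_,
        rfl⟩
      · rw [this]; exact isIsolated_univ_fin_one
      · rw [this, this])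
    (by
      rintro _ ⟨m, f, h, hf, hh, -, -, rfl⟩
      exact isClosed_eq ((continuous_code α hf).comp continuous_fst)
        ((continuous_code β hh).comp continuous_snd))
    (by
      rintro _ ⟨m, f, h, hf, hh, -, hr, rfl⟩ x
      obtain ⟨y, hy⟩ : code α f x ∈ Set.range (code β h) := hr ▸ ⟨x, rfl⟩
      exact ⟨y, hy.symm⟩)
    (by
      rintro _ ⟨m, f, h, hf, hh, -, hr, rfl⟩ y
      obtain ⟨x, hx⟩ : code β h y ∈ Set.range (code α f) := hr ▸ ⟨y, rfl⟩
      exact ⟨x, hx⟩)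
    (by
      rintro _ ⟨m, f, h, hf, hh, hiso, hr, rfl⟩ K hK
      obtain ⟨m', f', h', l, hf', hh', hl, hl', hiso', hr', hsep⟩ :=
        exists_extension hα hβ' hf hh hiso hr hK
      refine ⟨_, ⟨m', f', h', hf', hh', hiso', hr', rfl⟩, hrefine hl hl', fun x x' y h1 h2 => ?_⟩
      have h1 : code α f' x = code β h' y := h1
      have h2 : code α f' x' = code β h' y := h2
      refine hsep x x' ?_
      rw [← code_one α f' x, h1, ← h2, code_one])
    (by
      rintro _ ⟨m, f, h, hf, hh, hiso, hr, rfl⟩ K hK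
      obtain ⟨m', h', f', l, hh', hf', hl', hl, hiso', hr', hsep⟩ :=
        exists_extension hβ hα' hh hf (hr ▸ hiso) hr.symm hK
      refine ⟨_, ⟨m', f', h', hf', hh', hr' ▸ hiso', hr'.symm, rfl⟩, hrefine hl hl',
        fun x y y' h1 h2 => ?_⟩
      have h1 : code α f' x = code β h' y := h1
      have h2 : code α f' x = code β h' y' := h2
      refine hsep y y' ?_
      rw [← code_one β h' y, ← h1, h2, code_one])
  refine ⟨φ, fun g => ?_⟩
  have hequiv : ∀ x, φ (α.1 g x) = β.1 g (φ x) := fun x => by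
    rw [hφ]
    intro n
    obtain ⟨m, f, h, -, -, -, -, hRn⟩ := hR n
    have := (hφ x (φ x)).1 rfl n
    rw [hRn] at this ⊢
    have this : code α f x = code β h (φ x) := this
    change code α f (α.1 g x) = code β h (β.1 g (φ x))
    rw [code_act, code_act, this]
  funext y
  simp [hequiv]

instance [Countable G] : BaireSpace (ActSpace G) := by
  have hcl : IsClosed {α : G → C(Cantor, Cantor) | IsAction G α} := by
    have : {α : G → C(Cantor, Cantor) | IsAction G α} = {α | α 1 = ContinuousMap.id Cantor} ∩
        ⋂ g, ⋂ h, {α | α (g * h) = (α g).comp (α h)} := by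
      ext; simp [IsAction]
    rw [this]
    refine (isClosed_eq (continuous_apply 1) continuous_const).inter
      (isClosed_iInter fun g => isClosed_iInter fun h => isClosed_eq (continuous_apply _) ?_)
    exact (continuous_apply (A := fun _ : G => C(Cantor, Cantor)) g).compCM (continuous_apply h)
  have : TopologicalSpace.IsCompletelyMetrizableSpace C(Cantor, Cantor) := by
    have : (uniformity Bool).IsCountablyGenerated := by
      rw [discreteUniformity_iff_eq_principal_setRelId.1 inferInstance]
      infer_instance
    exact .of_completeSpace_metrizable
  have : TopologicalSpace.IsCompletelyMetrizableSpace (ActSpace G) :=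
    hcl.isClosedEmbedding_subtypeVal.IsCompletelyMetrizableSpace
  infer_instance

/-- Density of strongly projectively isolated subshifts implies the strong topological Rokhlin
property. -/
theorem IsolatedDense.hasSTRP [Countable G] (hG : IsolatedDense G) : HasSTRP G := by
  have hSFT : ∀ m : ℕ, Countable {X : Set (G → Fin m) // IsSFT G (Fin m) X} :=
    fun m => countable_isSFT _
  let D₁ : Set (ActSpace G) := ⋂ (m : ℕ) (f : LocallyConstant Cantor (Fin m)),
    {α | RefinesIsolated f α}
  let D₂ : Set (ActSpace G) := ⋂ (m : ℕ) (m' : ℕ) (f : LocallyConstant Cantor (Fin m))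
    (l : Fin m' → Fin m) (Y : {X : Set (G → Fin m') // IsSFT G (Fin m') X}),
    {α | IsIsolated G (Fin m') Y.1 → LiftsAlong f l Y.1 α}
  have h₁ : D₁ ∈ residual (ActSpace G) := by
    simp only [D₁, countable_iInter_mem]
    exact fun m f => residual_of_dense_open (isOpen_refinesIsolated f)
      (dense_refinesIsolated hG f.isLocallyConstant)
  have h₂ : D₂ ∈ residual (ActSpace G) := by
    simp only [D₂, countable_iInter_mem]
    intro m m' f l Y
    by_cases hY : IsIsolated G (Fin m') Y.1
    · simp only [hY, forall_const]
      exact residual_of_dense_open (isOpen_liftsAlong f.isLocallyConstant l hY)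
        (dense_liftsAlong f.isLocallyConstant l hY.1.isSubshift)
    · simp [hY]
  have hD := Filter.inter_mem h₁ h₂
  have hgen : ∀ α ∈ D₁ ∩ D₂,
      (∀ (m : ℕ) (f : Cantor → Fin m), IsLocallyConstant f → RefinesIsolated f α) ∧
      ∀ (m m' : ℕ) (f : Cantor → Fin m) (l : Fin m' → Fin m) (Y : Set (G → Fin m')),
        IsLocallyConstant f → IsIsolated G (Fin m') Y → LiftsAlong f l Y α := by
    rintro α ⟨hα₁, hα₂⟩
    simp only [D₁, D₂, Set.mem_iInter] at hα₁ hα₂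
    exact ⟨fun m f hf => hα₁ m ⟨f, hf⟩, fun m m' f l Y hf hY => hα₂ m m' ⟨f, hf⟩ l ⟨Y, hY.1⟩ hY⟩
  have : Nonempty (ActSpace G) := ⟨⟨fun _ => ContinuousMap.id Cantor, rfl, fun _ _ => rfl⟩⟩
  obtain ⟨α, hα⟩ := (dense_of_mem_residual hD).nonempty
  exact ⟨α, Filter.mem_of_superset hD fun β hβ => mem_conjClass_of_generic (hgen α hα).1
    (hgen α hα).2 (hgen β hβ).1 (hgen β hβ).2⟩

end Rokhlin

/-- Sequences over the factor group `H` carrying a distinguished centre: the letters `Sum.inl b` are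
centres, the letters `Sum.inr q` are the other ones, and `l` forgets the additional information. -/
structure IsRootedModel {H L Q : Type} [Group H] (S : Finset H) (E : H → L → L → Prop)
    (l : Q → L) (W : Set (H → L ⊕ Q)) : Prop where
  sft : ∃ (D : Finset H) (𝔽 : Set (D → L ⊕ Q)), ∀ w, w ∈ W ↔ ∀ h, (fun k : D => w (h * k)) ∈ 𝔽
  rel : ∀ w ∈ W, ∀ h, ∀ s ∈ S, E s (Sum.elim id l (w h)) (Sum.elim id l (w (h * s)))
  exists_center : ∀ b, ∃ w ∈ W, w 1 = Sum.inl b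
  eq_of_center : ∀ w ∈ W, ∀ w' ∈ W, ∀ b, w 1 = Sum.inl b → w' 1 = Sum.inl b → w = w'
  center_unique : ∀ w ∈ W, ∀ b b' h, w 1 = Sum.inl b → w h = Sum.inl b' → h = 1
  approx : ∀ w ∈ W, ∀ D : Finset H, ∃ w' ∈ W, (∀ k ∈ D, w' k = w k) ∧ ∃ h b, w' h = Sum.inl b

section Finite

theorem exists_isRootedModel_of_finite {H L : Type} [Group H] [Finite H] [Finite L]
    (S : Finset H) (E : H → L → L → Prop)
    (hE : ∀ b, ∃ u : H → L, u 1 = b ∧ ∀ h, ∀ s ∈ S, E s (u h) (u (h * s))) :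
    ∃ (Q : Type) (_ : Finite Q) (l : Q → L) (W : Set (H → L ⊕ Q)), IsRootedModel S E l W := by
  classical
  choose u hu1 hu using hE
  have := Fintype.ofFinite H
  let v : L → H → L ⊕ L × H := fun b h => if h = 1 then Sum.inl b else Sum.inr (b, h)
  have hv : ∀ b h, Sum.elim id (fun q : L × H => u q.1 q.2) (v b h) = u b h := fun b h => by
    by_cases hh : h = 1 <;> simp [v, hh, hu1]
  have hv1 : ∀ b h c, v b h = Sum.inl c → h = 1 ∧ b = c := fun b h c => by
    by_cases hh : h = 1 <;> simp [v, hh]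
  have center : ∀ b b' g, v b (g * 1) = Sum.inl b' → g = 1 ∧ b = b' := fun b b' g h => by
    simpa using hv1 _ _ _ h
  refine ⟨L × H, inferInstance, fun q => u q.1 q.2, {w | ∃ b g, w = fun h => v b (g * h)},
    ⟨Finset.univ, {p | ∃ b g, p = fun h => v b (g * h.1)}, fun w => ⟨?_, fun h => ?_⟩⟩,
    ?_, fun b => ⟨v b, ⟨b, 1, by simp⟩, by simp [v]⟩, ?_, ?_, ?_⟩
  · rintro ⟨b, g, rfl⟩ h
    exact ⟨b, g * h, by simp [mul_assoc]⟩
  · obtain ⟨b, g, hg⟩ := h 1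
    refine ⟨b, g, funext fun k => ?_⟩
    simpa using congrFun hg ⟨k, Finset.mem_univ k⟩
  · rintro _ ⟨b, g, rfl⟩ h s hs
    simp only [hv, ← mul_assoc]
    exact hu b _ s hs
  · rintro _ ⟨b, g, rfl⟩ _ ⟨b', g', rfl⟩ c h h'
    obtain ⟨rfl, rfl⟩ := center _ _ _ h
    obtain ⟨rfl, rfl⟩ := center _ _ _ h'
    rfl
  · rintro _ ⟨b, g, rfl⟩ c c' h h1 h2
    obtain ⟨rfl, rfl⟩ := center _ _ _ h1
    simpa using (hv1 _ _ _ h2).1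
  · rintro _ ⟨b, g, rfl⟩ D
    exact ⟨_, ⟨b, g, rfl⟩, fun _ _ => rfl, g⁻¹, b, by simp [v]⟩

end Finite

section Cyclic

/-- The successor map of the ray `0, 1, 2, …` wrapped at `a₂` back to `a₁`. -/
def wrapSucc (a : ℤ × ℤ) (σ : ℤ) : ℤ := if σ + 1 = a.2 then a.1 else σ + 1

/-- The transitions of a line with both ends wrapped, the left one according to `c`. -/
def WrapStep (a c : ℤ × ℤ) (σ τ : ℤ) : Prop :=
  (-c.2 < σ ∧ σ < a.2 ∧ -c.2 < τ ∧ τ < a.2) ∧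
    (0 ≤ σ ∧ τ = wrapSucc a σ ∨ τ ≤ 0 ∧ -σ = wrapSucc c (-τ))

variable {a c : ℤ × ℤ}

theorem WrapStep.neg {σ τ : ℤ} (h : WrapStep a c σ τ) : WrapStep c a (-τ) (-σ) := by
  obtain ⟨h1, h2⟩ := h
  refine ⟨by omega, ?_⟩
  rcases h2 with h2 | h2
  · exact .inr ⟨by omega, by simpa using h2.2⟩
  · exact .inl ⟨by omega, h2.2⟩

/-- Bi-infinite paths of the transition relation `WrapStep`. -/
def IsWrapPath (a c : ℤ × ℤ) (v : ℤ → ℤ) : Prop := ∀ n, WrapStep a c (v n) (v (n + 1))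

theorem IsWrapPath.neg {v : ℤ → ℤ} (h : IsWrapPath a c v) :
    IsWrapPath c a fun n => -v (-n) := fun n => by
  have := (h (-(n + 1))).neg
  rwa [show -(n + 1) + 1 = -n by ring] at this

theorem wrapSucc_pos (ha : 0 < a.1) {σ : ℤ} (hσ : 0 ≤ σ) : 0 < wrapSucc a σ := by
  unfold wrapSucc; split_ifs <;> omega

theorem wrapSucc_lt (ha : a.1 < a.2) {σ : ℤ} (hσ : σ < a.2) : wrapSucc a σ < a.2 := by
  unfold wrapSucc; split_ifs <;> omega

theorem WrapStep.eq_wrapSucc (hc : 0 < c.1) {σ τ : ℤ} (h : WrapStep a c σ τ) (hσ : 0 ≤ σ) :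
    τ = wrapSucc a σ := by
  rcases h.2 with h2 | h2
  · exact h2.2
  · have := wrapSucc_pos hc (σ := -τ) (by omega)
    omega

theorem WrapStep.nonpos {σ τ : ℤ} (h : WrapStep a c σ τ) (hσ : σ < 0) : τ ≤ 0 := by
  rcases h.2 with h2 | h2 <;> omega

theorem IsWrapPath.pos {v : ℤ → ℤ} (h : IsWrapPath a c v) (ha : 0 < a.1) (hc : 0 < c.1) {n : ℤ}
    (hn : 0 ≤ v n) (k : ℕ) : 0 < v (n + (k + 1)) := by
  induction k with
  | zero =>
    have := (h n).eq_wrapSucc hc hn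
    simpa [this] using wrapSucc_pos ha hn
  | succ k ih =>
    have := (h (n + (k + 1))).eq_wrapSucc hc ih.le
    push_cast
    rw [show n + (k + 1 + 1 : ℤ) = n + (k + 1) + 1 by ring, this]
    exact wrapSucc_pos ha ih.le

theorem IsWrapPath.eq_right {v v' : ℤ → ℤ} (h : IsWrapPath a c v) (h' : IsWrapPath a c v')
    (ha : 0 < a.1) (hc : 0 < c.1) (h0 : v 0 = 0) (h0' : v' 0 = 0) (k : ℕ) : v k = v' k := by
  induction k with
  | zero => simp [h0, h0']
  | succ k ih =>
    have hk : 0 ≤ v k := by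
      cases k with
      | zero => simp [h0]
      | succ k => simpa using (h.pos ha hc h0.ge k).le
    push_cast
    rw [(h k).eq_wrapSucc hc hk, (h' k).eq_wrapSucc hc (ih ▸ hk), ih]

theorem IsWrapPath.eq {v v' : ℤ → ℤ} (h : IsWrapPath a c v) (h' : IsWrapPath a c v')
    (ha : 0 < a.1) (hc : 0 < c.1) (h0 : v 0 = 0) (h0' : v' 0 = 0) : v = v' := by
  funext n
  obtain ⟨k, rfl | rfl⟩ := n.eq_nat_or_neg
  · exact h.eq_right h' ha hc h0 h0' k
  · simpa using h.neg.eq_right h'.neg hc ha (by simpa using h0) (by simpa using h0') k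

theorem IsWrapPath.eq_zero {v : ℤ → ℤ} (h : IsWrapPath a c v)
    (ha : 0 < a.1) (hc : 0 < c.1) (h0 : v 0 = 0) {n : ℤ} (hn : v n = 0) : n = 0 := by
  obtain ⟨k, rfl | rfl⟩ := n.eq_nat_or_neg
  · cases k with
    | zero => rfl
    | succ k =>
      have := h.pos ha hc h0.ge k
      push_cast at hn
      rw [zero_add] at this
      omega
  · cases k with
    | zero => rfl
    | succ k =>
      have := h.neg.pos hc ha (n := 0) (by simp [h0]) k
      push_cast at hn
      rw [zero_add] at this
      omega

theorem IsWrapPath.exists_eq_zero {v : ℤ → ℤ} (h : IsWrapPath a c v) {n : ℤ} (hn : v n ≤ 0)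
    {k : ℕ} (hk : 0 ≤ v (n + k)) : ∃ j : ℕ, j ≤ k ∧ v (n + j) = 0 := by
  induction k with
  | zero => exact ⟨0, le_rfl, le_antisymm (by simpa using hn) hk⟩
  | succ k ih =>
    by_cases hk' : 0 ≤ v (n + k)
    · obtain ⟨j, hj, hj'⟩ := ih hk'
      exact ⟨j, by omega, hj'⟩
    · refine ⟨k + 1, le_rfl, le_antisymm ?_ hk⟩
      have := (h (n + k)).nonpos (by omega)
      push_cast
      rwa [← add_assoc]

theorem exists_extend_right (ha : 0 < a.1) (ha' : a.1 < a.2) (hc : 0 < c.1) (hc' : c.1 < c.2)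
    (v : ℤ → ℤ) (N : ℤ) (hN : 0 ≤ v N) (hN' : v N < a.2) :
    ∃ v' : ℤ → ℤ, (∀ n ≤ N, v' n = v n) ∧ ∀ n, N ≤ n → WrapStep a c (v' n) (v' (n + 1)) := by
  have key : ∀ k : ℕ, 0 ≤ (wrapSucc a)^[k] (v N) ∧ (wrapSucc a)^[k] (v N) < a.2 := fun k => by
    induction k with
    | zero => exact ⟨hN, hN'⟩
    | succ k ih =>
      rw [Function.iterate_succ_apply']
      exact ⟨(wrapSucc_pos ha ih.1).le, wrapSucc_lt ha' ih.2⟩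
  refine ⟨fun n => if n ≤ N then v n else (wrapSucc a)^[(n - N).toNat] (v N),
    fun n hn => if_pos hn, fun n hn => ?_⟩
  obtain ⟨k, rfl⟩ := Int.le.dest hn
  have e1 : (if N + (k : ℤ) ≤ N then v (N + k) else (wrapSucc a)^[(N + k - N).toNat] (v N)) =
      (wrapSucc a)^[k] (v N) := by
    split_ifs with h
    · obtain rfl : k = 0 := by omega
      simp
    · rw [show (N + (k : ℤ) - N).toNat = k by omega]
  have e2 : (if N + (k : ℤ) + 1 ≤ N then v (N + k + 1)
      else (wrapSucc a)^[(N + k + 1 - N).toNat] (v N)) = wrapSucc a ((wrapSucc a)^[k] (v N)) := by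
    rw [if_neg (by omega), show (N + (k : ℤ) + 1 - N).toNat = k + 1 by omega,
      Function.iterate_succ_apply']
  beta_reduce
  rw [e1, e2]
  have := key k
  have := wrapSucc_pos ha (key k).1
  have := wrapSucc_lt ha' (key k).2
  exact ⟨by omega, .inl ⟨(key k).1, rfl⟩⟩

theorem exists_extend_left (ha : 0 < a.1) (ha' : a.1 < a.2) (hc : 0 < c.1) (hc' : c.1 < c.2)
    (v : ℤ → ℤ) (N : ℤ) (hN : v N ≤ 0) (hN' : -c.2 < v N) :
    ∃ v' : ℤ → ℤ, (∀ n, N ≤ n → v' n = v n) ∧ ∀ n < N, WrapStep a c (v' n) (v' (n + 1)) := by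
  obtain ⟨v', h1, h2⟩ := exists_extend_right hc hc' ha ha' (fun n => -v (-n)) (-N)
    (by simpa using hN) (by simpa using (by omega : -v N < c.2))
  refine ⟨fun n => -v' (-n), fun n hn => by simp [h1 (-n) (by omega)], fun n hn => ?_⟩
  have := (h2 (-(n + 1)) (by omega)).neg
  rwa [show -(n + 1) + 1 = -n by ring] at this

theorem exists_isWrapPath (ha : 0 < a.1) (ha' : a.1 < a.2) (hc : 0 < c.1) (hc' : c.1 < c.2) :
    ∃ v, IsWrapPath a c v ∧ v 0 = 0 := by
  obtain ⟨v₁, h1, h2⟩ := exists_extend_right ha ha' hc hc' (fun _ => 0) 0 le_rfl (by omega)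
  obtain ⟨v₂, h3, h4⟩ := exists_extend_left ha ha' hc hc' v₁ 0 (h1 0 le_rfl).le
    (by rw [h1 0 le_rfl]; omega)
  refine ⟨v₂, fun n => ?_, by rw [h3 0 le_rfl, h1 0 le_rfl]⟩
  rcases lt_or_ge n 0 with hn | hn
  · exact h4 n hn
  · rw [h3 n hn, h3 (n + 1) (by omega)]
    exact h2 n hn

theorem IsWrapPath.exists_center_right (ha : 0 < a.1) (ha' : a.1 < a.2) (hc : 0 < c.1)
    (hc' : c.1 < c.2) {v : ℤ → ℤ} (h : IsWrapPath a c v) {K : ℤ} (hK : v K < 0) :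
    ∃ v', IsWrapPath a c v' ∧ (∀ n ≤ K, v' n = v n) ∧ ∃ n, v' n = 0 := by
  have hb := (h K).1
  obtain ⟨v', h1, h2⟩ := exists_extend_right ha ha' hc hc'
    (fun n => if n ≤ K then v n else v K + (n - K)) (K - v K) (by rw [if_neg (by omega)]; omega)
    (by rw [if_neg (by omega)]; omega)
  refine ⟨v', fun n => ?_, fun n hn => ?_, K - v K, ?_⟩
  · rcases le_or_gt (K - v K) n with hn | hn
    · exact h2 n hn
    rw [h1 n hn.le, h1 (n + 1) (by omega)]
    rcases lt_or_ge n K with hn' | hn'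
    · rw [if_pos hn'.le, if_pos (by omega)]
      exact h n
    · rw [if_neg (show ¬ n + 1 ≤ K by omega)]
      have : (if n ≤ K then v n else v K + (n - K)) = v K + (n - K) := by
        split_ifs with h
        · obtain rfl : n = K := le_antisymm h hn'
          ring
        · rfl
      rw [this]
      refine ⟨by omega, .inr ⟨by omega, ?_⟩⟩
      rw [wrapSucc, if_neg (by omega)]
      ring
  · rw [h1 n (by omega), if_pos hn]
  · rw [h1 _ le_rfl, if_neg (by omega)]
    ring

theorem IsWrapPath.exists_center (ha : 0 < a.1) (ha' : a.1 < a.2) (hc : 0 < c.1)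
    (hc' : c.1 < c.2) {v : ℤ → ℤ} (h : IsWrapPath a c v) (K : ℕ) :
    ∃ v', IsWrapPath a c v' ∧ (∀ n : ℤ, |n| ≤ K → v' n = v n) ∧ ∃ n, v' n = 0 := by
  by_cases h1 : v K < 0
  · obtain ⟨v', hv', h2, h3⟩ := h.exists_center_right ha ha' hc hc' h1
    exact ⟨v', hv', fun n hn => h2 n (le_of_abs_le hn), h3⟩
  by_cases h2 : 0 < v (-K)
  · obtain ⟨v', hv', h3, n, h4⟩ :=
      h.neg.exists_center_right hc hc' ha ha' (K := K) (by simpa using h2)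
    refine ⟨_, hv'.neg, fun n hn => ?_, -n, by simpa using h4⟩
    simp [h3 (-n) (by have := neg_le_of_abs_le hn; omega)]
  · obtain ⟨j, -, hj⟩ := h.exists_eq_zero (n := -K) (k := 2 * K) (by omega)
      (by rw [show -(K : ℤ) + (2 * K : ℕ) = K by push_cast; ring]; omega)
    exact ⟨v, h, fun _ _ => rfl, _, hj⟩

variable {L : Type}

/-- The values of `u` along the ray repeat at the wrapping point, with a margin `M`. -/
def IsWrapPoint (u : ℤ → L) (M : ℕ) (a : ℤ × ℤ) : Prop :=
  0 < a.1 ∧ a.1 < a.2 ∧ ∀ t : ℕ, t ≤ M → u (a.1 + t) = u (a.2 + t)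

theorem exists_isWrapPoint [Finite L] (u : ℤ → L) (M : ℕ) : ∃ a, IsWrapPoint u M a := by
  obtain ⟨i, j, hij, h⟩ := Finite.exists_ne_map_eq_of_infinite
    fun (k : ℕ) (t : Fin (M + 1)) => u (k + 1 + (t : ℕ))
  wlog hlt : i < j generalizing i j
  · exact this j i hij.symm h.symm (by omega)
  refine ⟨(i + 1, j + 1), by dsimp; omega, by dsimp; omega, fun t ht => ?_⟩
  exact congrFun h ⟨t, by omega⟩

theorem IsWrapPoint.apply_wrapSucc {u : ℤ → L} {M : ℕ} (ha : IsWrapPoint u M a) (σ : ℤ) {t : ℕ}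
    (ht : t ≤ M) : u (wrapSucc a σ + t) = u (σ + 1 + t) := by
  unfold wrapSucc
  split_ifs with h
  · rw [h, ha.2.2 t ht]
  · rfl

theorem IsWrapPath.apply_add {u : ℤ → L} {M : ℕ} (ha : IsWrapPoint u M a) (hc : 0 < c.1)
    {v : ℤ → ℤ} (h : IsWrapPath a c v) {t : ℕ} (ht : t ≤ M) {n : ℤ} (hn : 0 ≤ v n) :
    u (v (n + t)) = u (v n + t) := by
  induction t generalizing n with
  | zero => simp
  | succ t ih =>
    have h1 := (h n).eq_wrapSucc hc hn
    have h2 := wrapSucc_pos ha.1 hn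
    push_cast
    rw [show n + (t + 1 : ℤ) = n + 1 + t by ring, ih (by omega) (by omega), h1,
      ha.apply_wrapSucc _ (by omega)]
    congr 1
    ring

theorem IsWrapPath.apply_sub {u : ℤ → L} {M : ℕ} (hc : IsWrapPoint (fun n => u (-n)) M c)
    (ha : 0 < a.1) {v : ℤ → ℤ} (h : IsWrapPath a c v) {t : ℕ} (ht : t ≤ M) {n : ℤ}
    (hn : v n ≤ 0) : u (v (n - t)) = u (v n - t) := by
  have := h.neg.apply_add hc ha ht (n := -n) (by simpa using hn)
  simp only [neg_add, neg_neg] at this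
  simpa only [← sub_eq_add_neg] using this

/-- Along a wrapped path, `u` reads on every interval of length `M` as on some interval of `ℤ`. -/
theorem IsWrapPath.exists_window {u : ℤ → L} {M : ℕ} (ha : IsWrapPoint u M a)
    (hc : IsWrapPoint (fun n => u (-n)) M c) {v : ℤ → ℤ} (h : IsWrapPath a c v) (n : ℤ) :
    ∃ N, ∀ t : ℕ, t ≤ M → u (v (n + t)) = u (N + t) := by
  have h0 : ∀ j : ℕ, j ≤ M → v (n + j) ≤ 0 → 0 ≤ v (n + j) ∨ j = M →
      ∃ N, ∀ t : ℕ, t ≤ M → u (v (n + t)) = u (N + t) := by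
    refine fun j hj hv hj' => ⟨v (n + j) - j, fun t ht => ?_⟩
    rcases le_total j t with hjt | hjt
    · obtain ⟨k, rfl⟩ := Nat.exists_eq_add_of_le hjt
      rcases hj' with hj' | rfl
      · have := h.apply_add ha hc.1 (t := k) (by omega) hj'
        push_cast
        rw [← add_assoc, this]
        congr 1
        ring
      · obtain rfl : k = 0 := by omega
        simp
    · obtain ⟨k, rfl⟩ := Nat.exists_eq_add_of_le hjt
      have := h.apply_sub hc ha.1 (t := k) (by omega) hv
      push_cast at this ⊢
      rw [show n + (t + k : ℤ) - k = n + t by ring] at this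
      rw [this]
      congr 1
      ring
  by_cases h1 : 0 ≤ v n
  · exact ⟨v n, fun t ht => h.apply_add ha hc.1 ht h1⟩
  by_cases h2 : v (n + M) ≤ 0
  · exact h0 M le_rfl h2 (.inr rfl)
  obtain ⟨j, hj, hj'⟩ := h.exists_eq_zero (n := n) (k := M) (by omega) (by omega)
  exact h0 j hj hj'.le (.inl hj'.ge)

theorem IsWrapPath.rel {u : ℤ → L} {M : ℕ} (ha : IsWrapPoint u M a)
    (hc : IsWrapPoint (fun n => u (-n)) M c) {v : ℤ → ℤ} (h : IsWrapPath a c v)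
    {E : L → L → Prop} {s : ℤ} (hs : |s| ≤ M) (hE : ∀ n, E (u n) (u (n + s))) (n : ℤ) :
    E (u (v n)) (u (v (n + s))) := by
  obtain ⟨k, rfl | rfl⟩ := s.eq_nat_or_neg
  · obtain ⟨N, hN⟩ := h.exists_window ha hc n
    have h0 := hN 0 (by omega)
    have hk := hN k (by simpa using hs)
    simp only [Nat.cast_zero, add_zero] at h0
    rw [h0, hk]
    exact hE N
  · obtain ⟨N, hN⟩ := h.exists_window ha hc (n + -k)
    have h0 := hN 0 (by omega)
    have hk := hN k (by simpa using hs)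
    simp only [Nat.cast_zero, add_zero, neg_add_cancel_right] at h0 hk
    rw [h0, hk]
    simpa using hE (N + k)

theorem exists_isRootedModel_of_equiv_int {H : Type} [Group H] [Finite L]
    (e : ℤ ≃ H) (he : ∀ m n, e (m + n) = e m * e n)
    (S : Finset H) (E : H → L → L → Prop)
    (hE : ∀ b, ∃ u : H → L, u 1 = b ∧ ∀ h, ∀ s ∈ S, E s (u h) (u (h * s))) :
    ∃ (Q : Type) (_ : Finite Q) (l : Q → L) (W : Set (H → L ⊕ Q)), IsRootedModel S E l W := by
  classical
  have he0 : e 0 = 1 := by simpa using he 0 0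
  have bound : ∀ D : Finset H, ∃ M : ℕ, ∀ s, e s ∈ D → |s| ≤ M := fun D => by
    refine ⟨∑ h ∈ D, (e.symm h).natAbs, fun s hs => ?_⟩
    have := Finset.single_le_sum (f := fun h => (e.symm h).natAbs) (fun _ _ => Nat.zero_le _) hs
    rw [Equiv.symm_apply_apply] at this
    rw [Int.abs_eq_natAbs]
    exact_mod_cast this
  obtain ⟨M, hM⟩ := bound S
  choose u' hu1 hu using hE
  let u : L → ℤ → L := fun b n => u' b (e n)
  choose a ha using fun b => exists_isWrapPoint (u b) M
  choose c hc using fun b => exists_isWrapPoint (fun n => u b (-n)) M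
  let Q : Type := {p : L × ℤ // p.2 ≠ 0 ∧ -(c p.1).2 < p.2 ∧ p.2 < (a p.1).2}
  have hQ : Finite Q := by
    have : Set.Finite (⋃ b : L, (fun σ => (b, σ)) '' Set.Ioo (-(c b).2) (a b).2) :=
      Set.finite_iUnion fun b => (Set.finite_Ioo _ _).image _
    refine (this.subset (t := {p : L × ℤ | p.2 ≠ 0 ∧ -(c p.1).2 < p.2 ∧ p.2 < (a p.1).2}) ?_).to_subtype
    rintro ⟨b, σ⟩ hp
    exact Set.mem_iUnion.2 ⟨b, σ, hp.2, rfl⟩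
  let dec : L ⊕ Q → L × ℤ := Sum.elim (fun b => (b, 0)) Subtype.val
  have hdec : Function.Injective dec := by
    rintro (b | q) (b' | q') h
    · simpa [dec] using h
    · exact absurd (congrArg Prod.snd h).symm q'.2.1
    · exact absurd (congrArg Prod.snd h) q.2.1
    · exact congrArg _ (Subtype.ext h)
  have hdec0 : ∀ x b, x = Sum.inl b ↔ dec x = (b, 0) := fun x b =>
    (hdec.eq_iff (a := x) (b := Sum.inl b)).symm
  have hl : ∀ x, Sum.elim id (fun q : Q => u q.1.1 q.1.2) x = u (dec x).1 (dec x).2 := by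
    rintro (b | q)
    · simp [dec, u, he0, hu1]
    · rfl
  let P : L ⊕ Q → L ⊕ Q → Prop := fun x y => (dec y).1 = (dec x).1 ∧
    WrapStep (a (dec x).1) (c (dec x).1) (dec x).2 (dec y).2
  let W : Set (H → L ⊕ Q) := {w | ∀ n, P (w (e n)) (w (e (n + 1)))}
  have fwd : ∀ w ∈ W, ∃ b v, IsWrapPath (a b) (c b) v ∧ ∀ n, dec (w (e n)) = (b, v n) := by
    intro w hw
    have hb : ∀ n, (dec (w (e n))).1 = (dec (w (e 0))).1 := fun n => by
      induction n with
      | zero => rfl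
      | succ n ih => exact (hw _).1.trans ih
      | pred n ih =>
        rw [← ih]
        have := (hw (-n - 1)).1
        rw [sub_add_cancel] at this
        exact this.symm
    refine ⟨(dec (w (e 0))).1, fun n => (dec (w (e n))).2, fun n => ?_, fun n =>
      Prod.ext (hb n) rfl⟩
    rw [← hb n]
    exact (hw n).2
  have bwd : ∀ b v, IsWrapPath (a b) (c b) v → ∃ w ∈ W, ∀ n, dec (w (e n)) = (b, v n) := by
    intro b v hv
    have : ∀ n, ∃ x, dec x = (b, v n) := fun n => by
      by_cases h : v n = 0
      · exact ⟨Sum.inl b, by rw [h]; rfl⟩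
      · exact ⟨Sum.inr ⟨(b, v n), h, (hv n).1.1, (hv n).1.2.1⟩, rfl⟩
    choose x hx using this
    refine ⟨fun h => x (e.symm h), fun n => ?_, fun n => by simp [hx]⟩
    simp only [Equiv.symm_apply_apply, P, hx]
    exact ⟨trivial, hv n⟩
  refine ⟨Q, hQ, fun q => u q.1.1 q.1.2, W, ⟨{e 0, e 1}, {p | P (p ⟨e 0, by simp⟩)
    (p ⟨e 1, by simp⟩)}, fun w => ?_⟩, fun w hw h s hs => ?_, fun b => ?_, ?_, ?_, ?_⟩
  · refine ⟨fun hw h => ?_, fun hw n => ?_⟩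
    · obtain ⟨n, rfl⟩ := e.surjective h
      have := hw n
      simpa [← he] using this
    · have := hw (e n)
      simpa [← he] using this
  · obtain ⟨b, v, hv, hw⟩ := fwd w hw
    obtain ⟨n, rfl⟩ := e.surjective h
    obtain ⟨s, rfl⟩ := e.surjective s
    rw [hl, hl, ← he, hw, hw]
    exact hv.rel (ha b) (hc b) (E := E (e s)) (hM s hs)
      (fun n => by simpa only [u, he] using hu b (e n) _ hs) n
  · obtain ⟨v, hv, h0⟩ := exists_isWrapPath (ha b).1 (ha b).2.1 (hc b).1 (hc b).2.1
    obtain ⟨w, hw, hwv⟩ := bwd b v hv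
    exact ⟨w, hw, by rw [hdec0, ← he0, hwv, h0]⟩
  · intro w hw w' hw' b h h'
    obtain ⟨b₁, v, hv, hw⟩ := fwd w hw
    obtain ⟨b₂, v', hv', hw'⟩ := fwd w' hw'
    rw [hdec0, ← he0, hw, Prod.mk.injEq] at h
    rw [hdec0, ← he0, hw', Prod.mk.injEq] at h'
    obtain ⟨rfl, h⟩ := h
    obtain ⟨rfl, h'⟩ := h'
    obtain rfl := hv.eq hv' (ha _).1 (hc _).1 h h'
    funext k
    obtain ⟨n, rfl⟩ := e.surjective k
    exact hdec ((hw n).trans (hw' n).symm)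
  · intro w hw b b' k h h'
    obtain ⟨b₁, v, hv, hw⟩ := fwd w hw
    obtain ⟨n, rfl⟩ := e.surjective k
    rw [hdec0, ← he0, hw, Prod.mk.injEq] at h
    rw [hdec0, hw, Prod.mk.injEq] at h'
    rw [hv.eq_zero (ha _).1 (hc _).1 h.2 h'.2, he0]
  · intro w hw D
    obtain ⟨b, v, hv, hw⟩ := fwd w hw
    obtain ⟨K, hK⟩ := bound D
    obtain ⟨v', hv', h1, n, h2⟩ :=
      IsWrapPath.exists_center (ha b).1 (ha b).2.1 (hc b).1 (hc b).2.1 hv K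
    obtain ⟨w', hw', hwv⟩ := bwd b v' hv'
    refine ⟨w', hw', fun k hk => ?_, e n, b, by rw [hdec0, hwv, h2]⟩
    obtain ⟨m, rfl⟩ := e.surjective k
    exact hdec (by rw [hwv, hw, h1 m (hK m hk)])

end Cyclic

theorem exists_isRootedModel {H L : Type} [Group H] (hH : Finite H ∨ IsCyclic H) [Finite L]
    (S : Finset H) (E : H → L → L → Prop)
    (hE : ∀ b, ∃ u : H → L, u 1 = b ∧ ∀ h, ∀ s ∈ S, E s (u h) (u (h * s))) :
    ∃ (Q : Type) (_ : Finite Q) (l : Q → L) (W : Set (H → L ⊕ Q)), IsRootedModel S E l W := by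
  by_cases hfin : Finite H
  · exact exists_isRootedModel_of_finite S E hE
  have : Infinite H := not_finite_iff_infinite.1 hfin
  have := hH.resolve_left hfin
  exact exists_isRootedModel_of_equiv_int
    (Multiplicative.ofAdd.trans (intCyclicMulEquiv (G := H)).toEquiv)
    (fun m n => map_mul intCyclicMulEquiv (Multiplicative.ofAdd m) (Multiplicative.ofAdd n)) S E hE

section Syllables

open Monoid.CoprodI

variable {ι : Type} [DecidableEq ι] {G : ι → Type} [∀ i, Group (G i)] [∀ i, DecidableEq (G i)]

/-- The syllables of the reduced word of an element of a free product. -/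
def syllables (g : Monoid.CoprodI G) : List (Σ i, G i) := (Word.equiv g).toList

def StartsWith (i : ι) (g : Monoid.CoprodI G) : Prop := ∃ h r, syllables g = ⟨i, h⟩ :: r

def EndsWith (i : ι) (g : Monoid.CoprodI G) : Prop := ∃ h r, syllables g = r ++ [⟨i, h⟩]

theorem prod_syllables (g : Monoid.CoprodI G) : ((syllables g).map fun s => of s.2).prod = g :=
  Word.equiv.symm_apply_apply g

theorem syllables_eq (g : Monoid.CoprodI G) {r : List (Σ i, G i)} (h1 : ∀ s ∈ r, s.2 ≠ 1)
    (h2 : r.IsChain fun s t => s.1 ≠ t.1) (h3 : (r.map fun s => of s.2).prod = g) :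
    syllables g = r :=
  congrArg Word.toList ((Word.equiv.symm_apply_eq (x := (⟨r, h1, h2⟩ : Word G))).1 h3).symm

theorem syllables_inj {g g' : Monoid.CoprodI G} (h : syllables g = syllables g') : g = g' := by
  rw [← prod_syllables g, h, prod_syllables]

theorem syllables_one : syllables (1 : Monoid.CoprodI G) = [] :=
  syllables_eq 1 (by simp) (by simp) (by simp)

theorem syllables_mul_of {g : Monoid.CoprodI G} {i : ι} (hg : ¬ EndsWith i g) {h : G i}
    (hh : h ≠ 1) : syllables (g * of h) = syllables g ++ [⟨i, h⟩] := by
  refine syllables_eq _ ?_ ?_ (by simp [prod_syllables])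
  · intro s hs
    rcases List.mem_append.1 hs with hs | hs
    · exact (Word.equiv g).ne_one s hs
    · rw [List.mem_singleton] at hs
      subst hs
      exact hh
  · refine List.isChain_append.2 ⟨(Word.equiv g).chain_ne, by simp, ?_⟩
    rintro ⟨j, k⟩ hs t ht hj
    obtain rfl : t = ⟨i, h⟩ := by simpa using ht.symm
    obtain rfl : j = i := hj
    exact hg ⟨k, _, (List.dropLast_append_getLast? _ hs).symm⟩

theorem syllables_of_mul {g : Monoid.CoprodI G} {i : ι} (hg : ¬ StartsWith i g) {h : G i}
    (hh : h ≠ 1) : syllables (of h * g) = ⟨i, h⟩ :: syllables g := by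
  refine syllables_eq _ ?_ ?_ (by simp [prod_syllables])
  · intro s hs
    rcases List.mem_cons.1 hs with rfl | hs
    · exact hh
    · exact (Word.equiv g).ne_one s hs
  · refine List.isChain_cons.2 ⟨?_, (Word.equiv g).chain_ne⟩
    rintro ⟨j, k⟩ hs rfl
    obtain ⟨r, hr⟩ := List.head?_eq_some_iff.1 hs
    exact hg ⟨k, r, hr⟩

theorem not_endsWith_one (i : ι) : ¬ EndsWith i (1 : Monoid.CoprodI G) := by
  rintro ⟨h, r, hr⟩
  simp [syllables_one] at hr

theorem syllables_of {i : ι} {h : G i} (hh : h ≠ 1) : syllables (of h) = [⟨i, h⟩] := by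
  simpa [syllables_one] using syllables_mul_of (not_endsWith_one i) hh

theorem exists_of_syllables_eq_append {g : Monoid.CoprodI G} {i : ι} {h : G i}
    {r : List (Σ i, G i)} (hg : syllables g = r ++ [⟨i, h⟩]) :
    h ≠ 1 ∧ ∃ g', syllables g' = r ∧ ¬ EndsWith i g' ∧ g = g' * of h := by
  have h1 : ∀ s ∈ r ++ [⟨i, h⟩], s.2 ≠ 1 := hg ▸ (Word.equiv g).ne_one
  have h2 : (r ++ [(⟨i, h⟩ : Σ i, G i)]).IsChain fun s t => s.1 ≠ t.1 :=
    hg ▸ (Word.equiv g).chain_ne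
  have hr := syllables_eq _ (r := r) (fun s hs => h1 s (List.mem_append_left _ hs))
    (List.isChain_append.1 h2).1 rfl
  refine ⟨h1 ⟨i, h⟩ (by simp), _, hr, ?_, ?_⟩
  · rintro ⟨k, r', hr'⟩
    rw [hr] at hr'
    exact (List.isChain_append.1 h2).2.2 ⟨i, k⟩ (by simp [hr']) ⟨i, h⟩ (by simp) rfl
  · rw [← prod_syllables g, hg]
    simp

theorem exists_of_syllables_eq_cons {g : Monoid.CoprodI G} {i : ι} {h : G i}
    {r : List (Σ i, G i)} (hg : syllables g = ⟨i, h⟩ :: r) :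
    h ≠ 1 ∧ ∃ g', syllables g' = r ∧ ¬ StartsWith i g' ∧ g = of h * g' := by
  have h1 : ∀ s ∈ ⟨i, h⟩ :: r, s.2 ≠ 1 := hg ▸ (Word.equiv g).ne_one
  have h2 : ((⟨i, h⟩ : Σ i, G i) :: r).IsChain fun s t => s.1 ≠ t.1 :=
    hg ▸ (Word.equiv g).chain_ne
  have hr := syllables_eq _ (r := r) (fun s hs => h1 s (List.mem_cons_of_mem _ hs))
    (List.isChain_cons.1 h2).2 rfl
  refine ⟨h1 ⟨i, h⟩ (by simp), _, hr, ?_, ?_⟩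
  · rintro ⟨k, r', hr'⟩
    rw [hr] at hr'
    exact (List.isChain_cons.1 h2).1 ⟨i, k⟩ (by simp [hr']) rfl
  · rw [← prod_syllables g, hg]
    simp

theorem exists_eq_mul_of (i : ι) (g : Monoid.CoprodI G) :
    ∃ (g' : Monoid.CoprodI G) (h : G i), ¬ EndsWith i g' ∧ g = g' * of h := by
  by_cases hg : EndsWith i g
  · obtain ⟨h, r, hr⟩ := hg
    obtain ⟨-, g', -, h1, h2⟩ := exists_of_syllables_eq_append hr
    exact ⟨g', h, h1, h2⟩
  · exact ⟨g, 1, hg, by simp⟩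

theorem induction_syllables {P : Monoid.CoprodI G → Prop} (one : P 1)
    (mul_of : ∀ g (i : ι) (h : G i), ¬ EndsWith i g → h ≠ 1 → P g → P (g * of h)) (g) : P g := by
  generalize hr : syllables g = r
  induction r using List.reverseRecOn generalizing g with
  | nil => rwa [syllables_inj (hr.trans syllables_one.symm)]
  | append_singleton r s ih =>
    obtain ⟨hs, g', h1, h2, rfl⟩ := exists_of_syllables_eq_append hr
    exact mul_of g' _ _ h2 hs (ih g' h1)

end Syllables

section Model

open Monoid.CoprodI

variable {ι : Type} {G : ι → Type} [∀ i, Group (G i)] {L : Type} {Q : ι → Type}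

/-- Alphabet of the free product model: roots `Sum.inl b`, and letters of type `i`. -/
abbrev Letter (L : Type) (Q : ι → Type) : Type := L ⊕ Σ i, Q i

def HasType (i : ι) (x : Letter L Q) : Prop := ∃ q, x = Sum.inr ⟨i, q⟩

def Letter.base (l : ∀ i, Q i → L) : Letter L Q → L := Sum.elim id fun q => l q.1 q.2

open Classical in
/-- The letter as seen by the factor `i`, for which letters of other types are centres. -/
noncomputable def Letter.proj (l : ∀ i, Q i → L) (i : ι) : Letter L Q → L ⊕ Q i :=
  Sum.elim Sum.inl fun q => if h : q.1 = i then Sum.inr (h ▸ q.2) else Sum.inl (l q.1 q.2)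

def Letter.emb (i : ι) : L ⊕ Q i → Letter L Q := Sum.map id (Sigma.mk i)

variable (l : ∀ i, Q i → L)

@[simp] theorem Letter.proj_emb (i : ι) (x : L ⊕ Q i) : Letter.proj l i (Letter.emb i x) = x := by
  rcases x with b | q <;> simp [Letter.proj, Letter.emb]

theorem Letter.proj_of_not_hasType {i : ι} {x : Letter L Q} (hx : ¬ HasType i x) :
    Letter.proj l i x = Sum.inl (Letter.base l x) := by
  rcases x with b | ⟨j, q⟩
  · rfl
  · have : j ≠ i := by
      rintro rfl
      exact hx ⟨q, rfl⟩
    simp [Letter.proj, Letter.base, this]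

theorem Letter.hasType_iff {i : ι} {x : Letter L Q} :
    HasType i x ↔ ∃ q, Letter.proj l i x = Sum.inr q := by
  constructor
  · rintro ⟨q, rfl⟩
    exact ⟨q, by simp [Letter.proj]⟩
  · rintro ⟨q, hq⟩
    by_contra h
    simp [Letter.proj_of_not_hasType l h] at hq

theorem Letter.eq_of_proj_eq {i : ι} {x y : Letter L Q} (hx : HasType i x)
    (h : Letter.proj l i x = Letter.proj l i y) : x = y := by
  obtain ⟨q', rfl⟩ := (hasType_iff l).2 (h ▸ (hasType_iff l).1 hx)
  obtain ⟨q, rfl⟩ := hx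
  simp only [Letter.proj, Sum.elim_inr, dite_true, Sum.inr.injEq] at h
  rw [h]

theorem Letter.elim_proj (i : ι) (x : Letter L Q) :
    Sum.elim id (l i) (Letter.proj l i x) = Letter.base l x := by
  by_cases hx : HasType i x
  · obtain ⟨q, rfl⟩ := hx
    simp [Letter.proj, Letter.base]
  · simp [Letter.proj_of_not_hasType l hx]

theorem HasType.eq {i j : ι} {x : Letter L Q} (hi : HasType i x) (hj : HasType j x) : i = j := by
  obtain ⟨q, rfl⟩ := hi
  obtain ⟨q', hq'⟩ := hj
  simp only [Sum.inr.injEq, Sigma.mk.injEq] at hq'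
  exact hq'.1

theorem not_hasType_emb {i j : ι} (hij : i ≠ j) (x : L ⊕ Q j) :
    ¬ HasType i (Letter.emb j x : Letter L Q) := by
  rintro ⟨q, hq⟩
  rcases x with b | q'
  · simp [Letter.emb] at hq
  · simp only [Letter.emb, Sum.map_inr, Sum.inr.injEq, Sigma.mk.injEq] at hq
    exact hij hq.1.symm

theorem hasType_or_eq_inl (x : Letter L Q) : (∃ i, HasType i x) ∨ ∃ b, x = Sum.inl b := by
  rcases x with b | ⟨i, q⟩
  · exact .inr ⟨b, rfl⟩
  · exact .inl ⟨i, q, rfl⟩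

/-- The configurations all of whose lines in direction `i` belong to `W i`. -/
def lineShift (W : ∀ i, Set (G i → L ⊕ Q i)) : Set (Monoid.CoprodI G → Letter L Q) :=
  {y | ∀ g i, (fun h : G i => Letter.proj l i (y (g * of h))) ∈ W i}

variable {l} {W : ∀ i, Set (G i → L ⊕ Q i)}

theorem translate_mem_lineShift {y : Monoid.CoprodI G → Letter L Q} (hy : y ∈ lineShift l W)
    (g : Monoid.CoprodI G) : (fun k => y (g * k)) ∈ lineShift l W := fun k i => by
  simpa only [mul_assoc] using hy (g * k) i

variable {S : ∀ i, Finset (G i)} {E : ∀ i, G i → L → L → Prop}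

theorem IsRootedModel.translate_mem {H L Q : Type} [Group H] {S : Finset H} {E : H → L → L → Prop}
    {l : Q → L} {W : Set (H → L ⊕ Q)} (hW : IsRootedModel S E l W) {w : H → L ⊕ Q} (hw : w ∈ W)
    (h : H) : (fun k => w (h * k)) ∈ W := by
  obtain ⟨D, 𝔽, hD⟩ := hW.sft
  rw [hD] at hw ⊢
  intro k
  simpa only [mul_assoc] using hw (h * k)

theorem isSFT_lineShift [Finite ι] (hW : ∀ i, IsRootedModel (S i) (E i) (l i) (W i)) :
    IsSFT (Monoid.CoprodI G) (Letter L Q) (lineShift l W) := by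
  classical
  have := Fintype.ofFinite ι
  choose D 𝔽 hD using fun i => (hW i).sft
  refine ⟨Finset.univ.biUnion fun i => (D i).image (of (i := i)),
    {p | ∀ i, (fun k : D i => Letter.proj l i (p ⟨of k.1, Finset.mem_biUnion.2
      ⟨i, Finset.mem_univ i, Finset.mem_image_of_mem _ k.2⟩⟩)) ∈ 𝔽 i}, fun y => ?_⟩
  simp only [lineShift, Set.mem_ofPred_eq, hD, shift]
  constructor
  · intro h g i
    simpa using h g⁻¹ i 1
  · intro h g i k
    simpa [mul_assoc] using h (g * of k)⁻¹ i

section Graft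

variable [DecidableEq ι] [∀ i, DecidableEq (G i)]

theorem IsRootedModel.eq_of_root (hW : ∀ i, IsRootedModel (S i) (E i) (l i) (W i))
    {y y' : Monoid.CoprodI G → Letter L Q} (hy : y ∈ lineShift l W) (hy' : y' ∈ lineShift l W)
    {b : L} (h : y 1 = Sum.inl b) (h' : y' 1 = Sum.inl b) : y = y' := by
  have key : ∀ g, y g = y' g ∧ ∀ i, ¬ EndsWith i g → ¬ HasType i (y g) := by
    refine induction_syllables ⟨h.trans h'.symm, ?_⟩ ?_
    · rintro i - ⟨q, hq⟩
      simp [h] at hq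
    · rintro g i k hg hk ⟨h1, h2⟩
      have h3 : Letter.proj (Q := Q) l i (y (g * of (1 : G i))) = Sum.inl (Letter.base l (y g)) := by
        rw [map_one, mul_one, Letter.proj_of_not_hasType l (h2 i hg)]
      have h3' : Letter.proj (Q := Q) l i (y' (g * of (1 : G i))) =
          Sum.inl (Letter.base l (y g)) := by
        rw [map_one, mul_one, ← h1, Letter.proj_of_not_hasType l (h2 i hg)]
      have h4 : HasType i (y (g * of k)) := by
        rw [Letter.hasType_iff l]
        rcases h5 : Letter.proj l i (y (g * of k)) with b' | q
        · exact absurd ((hW i).center_unique _ (hy g i) _ b' k h3 h5) hk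
        · exact ⟨q, rfl⟩
      refine ⟨Letter.eq_of_proj_eq l h4
        (congrFun ((hW i).eq_of_center _ (hy g i) _ (hy' g i) _ h3 h3') k), fun j hj h5 => ?_⟩
      obtain rfl := h4.eq h5
      exact hj ⟨k, _, syllables_mul_of hg hk⟩
  exact funext fun g => (key g).1

/-- The configuration which is `c` at the identity, continues as `y` through the first syllables
without a seed, and grows freely from the other ones. -/
def graft (l : ∀ i, Q i → L) (ctr : ∀ i, L → G i → L ⊕ Q i) (c : Letter L Q)
    (seed : (Σ i, G i) → Option (Letter L Q)) (y : Monoid.CoprodI G → Letter L Q)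
    (g : Monoid.CoprodI G) : Letter L Q :=
  match syllables g with
  | [] => c
  | s :: r => (seed s).elim (y g) fun d =>
      r.foldl (fun d s => Letter.emb s.1 (ctr s.1 (Letter.base l d) s.2)) d

variable {ctr : ∀ i, L → G i → L ⊕ Q i} {c : Letter L Q}
  {seed : (Σ i, G i) → Option (Letter L Q)} {y : Monoid.CoprodI G → Letter L Q}

theorem graft_one : graft l ctr c seed y 1 = c := by
  simp [graft, syllables_one]

theorem graft_of_syllables_eq {g : Monoid.CoprodI G} {s : Σ i, G i} {r : List (Σ i, G i)}
    (hg : syllables g = s :: r) : graft l ctr c seed y g = (seed s).elim (y g) fun d =>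
      r.foldl (fun d s => Letter.emb s.1 (ctr s.1 (Letter.base l d) s.2)) d := by
  rw [graft, hg]

theorem graft_of {i : ι} {h : G i} (hh : h ≠ 1) :
    graft l ctr c seed y (of h) = (seed ⟨i, h⟩).getD (y (of h)) := by
  rw [graft_of_syllables_eq (syllables_of hh)]
  rcases seed ⟨i, h⟩ with _ | d <;> rfl

theorem graft_of_seed_eq_none {g : Monoid.CoprodI G} {s : Σ i, G i} {r : List (Σ i, G i)}
    (hg : syllables g = s :: r) (hs : seed s = none) : graft l ctr c seed y g = y g := by
  rw [graft_of_syllables_eq hg, hs, Option.elim_none]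

theorem graft_mem (hW : ∀ i, IsRootedModel (S i) (E i) (l i) (W i))
    (hctr : ∀ i b, ctr i b ∈ W i) (hctr1 : ∀ i b, ctr i b 1 = Sum.inl b)
    (hy : ∀ s, seed s = none → y ∈ lineShift l W)
    (hs : ∀ s d, seed s = some d → ∀ j ≠ s.1, ¬ HasType j d)
    (h1 : ∀ i, (fun h : G i => Letter.proj l i (graft l ctr c seed y (of h))) ∈ W i) :
    graft l ctr c seed y ∈ lineShift l W := by
  intro g i
  obtain ⟨g, k, hg, rfl⟩ := exists_eq_mul_of i g
  suffices h : (fun h : G i => Letter.proj l i (graft l ctr c seed y (g * of h))) ∈ W i by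
    simpa only [mul_assoc, ← map_mul] using (hW i).translate_mem h k
  rcases hr : syllables g with _ | ⟨s, r⟩
  · obtain rfl := syllables_inj (hr.trans syllables_one.symm)
    simpa using h1 i
  have hsyl : ∀ h : G i, ∃ r', syllables (g * of h) = s :: r' := fun h => by
    by_cases hh : h = 1
    · exact ⟨r, by simp [hh, hr]⟩
    · exact ⟨r ++ [⟨i, h⟩], by simp [syllables_mul_of hg hh, hr]⟩
  rcases hd : seed s with _ | d
  · have : ∀ h : G i, graft l ctr c seed y (g * of h) = y (g * of h) := fun h => by
      obtain ⟨r', hr'⟩ := hsyl h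
      exact graft_of_seed_eq_none hr' hd
    simp only [this]
    exact hy s hd g i
  · set e := r.foldl (fun d s => Letter.emb s.1 (ctr s.1 (Letter.base l d) s.2)) d with he
    have hei : ¬ HasType i e := by
      rcases List.eq_nil_or_concat' r with rfl | ⟨r', t, rfl⟩
      · refine hs s d hd i ?_
        rintro rfl
        exact hg ⟨s.2, [], by simp [hr]⟩
      · rw [he, List.foldl_append, List.foldl_cons, List.foldl_nil]
        refine not_hasType_emb ?_ _
        rintro rfl
        exact hg ⟨t.2, s :: r', by simp [hr]⟩
    convert hctr i (Letter.base l e) using 1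
    funext h
    by_cases hh : h = 1
    · subst hh
      rw [hctr1, map_one, mul_one, graft_of_syllables_eq hr, hd]
      exact Letter.proj_of_not_hasType l hei
    · rw [graft_of_syllables_eq ((syllables_mul_of hg hh).trans (hr ▸ List.cons_append))]
      simp only [hd, Option.elim_some, List.foldl_append, List.foldl_cons, List.foldl_nil,
        Letter.proj_emb, he]

/-- Any root letter extends to a configuration. -/
theorem exists_root (hW : ∀ i, IsRootedModel (S i) (E i) (l i) (W i)) (J : Set ι)
    (c : Letter L Q) (y : Monoid.CoprodI G → Letter L Q)
    (hy : J.Nonempty → y ∈ lineShift l W ∧ Letter.base l (y 1) = Letter.base l c)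
    (hJ : ∀ i ∈ J, ¬ HasType i (y 1)) :
    ∃ y' ∈ lineShift l W, y' 1 = Sum.inl (Letter.base l c) ∧
      ∀ g, (∃ i ∈ J, StartsWith i g) → y' g = y g := by
  classical
  choose ctr hctr hctr1 using fun i => (hW i).exists_center
  refine ⟨graft l ctr (Sum.inl (Letter.base l c))
    (fun s => if s.1 ∈ J then none else some (Letter.emb s.1 (ctr s.1 (Letter.base l c) s.2))) y,
    graft_mem hW hctr hctr1 (fun s hs => ?_) (fun s d hs j hj => ?_) fun i => ?_, graft_one, ?_⟩
  · have : s.1 ∈ J := by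
      by_contra h
      simp [h] at hs
    exact (hy ⟨_, this⟩).1
  · by_cases h : s.1 ∈ J
    · simp [h] at hs
    · simp only [h, if_false, Option.some.injEq] at hs
      rw [← hs]
      exact not_hasType_emb hj _
  · by_cases h : i ∈ J
    · convert (hy ⟨i, h⟩).1 1 i using 1
      funext k
      by_cases hk : k = 1
      · rw [hk, map_one, graft_one, mul_one, Letter.proj_of_not_hasType l (hJ i h),
          (hy ⟨i, h⟩).2]
        rfl
      · rw [graft_of hk]
        simp [h]
    · convert hctr i (Letter.base l c) using 1
      funext k
      by_cases hk : k = 1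
      · rw [hk, map_one, graft_one, hctr1]
        rfl
      · rw [graft_of hk]
        simp [h]
  · rintro g ⟨i, hi, h, r, hr⟩
    exact graft_of_seed_eq_none hr (by simp [hi])

/-- Replacing one line through the identity by a line with a centre. -/
theorem exists_center_on_line (hW : ∀ i, IsRootedModel (S i) (E i) (l i) (W i))
    {y : Monoid.CoprodI G → Letter L Q} (hy : y ∈ lineShift l W) (i : ι)
    (F : Finset (Monoid.CoprodI G)) :
    ∃ y' ∈ lineShift l W, (∀ g ∈ F, y' g = y g) ∧ y' 1 = y 1 ∧
      ∃ h : G i, ¬ HasType i (y' (of h)) := by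
  classical
  choose ctr hctr hctr1 using fun i => (hW i).exists_center
  let hd : Monoid.CoprodI G → G i := fun g =>
    match syllables g with
    | [] => 1
    | s :: _ => if h : s.1 = i then h ▸ s.2 else 1
  have hhd : ∀ {g : Monoid.CoprodI G} {h : G i} {r}, syllables g = ⟨i, h⟩ :: r → hd g = h :=
    fun h => by simp [hd, h]
  let w : G i → L ⊕ Q i := fun h => Letter.proj l i (y (of h))
  have hw : w ∈ W i := by simpa using hy 1 i
  obtain ⟨w', hw', h1, h0, b, h2⟩ := (hW i).approx w hw (insert 1 (F.image hd))
  let seed : (Σ i, G i) → Option (Letter L Q) := fun s =>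
    if h : s.1 = i then
      if w' (h ▸ s.2) = w (h ▸ s.2) then none else some (Letter.emb i (w' (h ▸ s.2)))
    else none
  have hseed : ∀ h : G i, seed ⟨i, h⟩ = if w' h = w h then none else some (Letter.emb i (w' h)) :=
    fun h => by simp [seed]
  have hline : ∀ h : G i, Letter.proj l i (graft l ctr (y 1) seed y (of h)) = w' h := fun h => by
    by_cases hh : h = 1
    · subst hh
      rw [map_one, graft_one, h1 1 (by simp)]
      simp [w]
    · rw [graft_of hh, hseed]
      split_ifs with h3
      · exact h3.symm
      · simp
  refine ⟨graft l ctr (y 1) seed y, graft_mem hW hctr hctr1 (fun _ _ => hy) ?_ fun j => ?_, ?_,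
    graft_one, h0, ?_⟩
  · intro s d hs j hj
    by_cases h : s.1 = i
    · obtain ⟨k, a⟩ := s
      obtain rfl : k = i := h
      rw [hseed] at hs
      split_ifs at hs
      obtain rfl := Option.some.inj hs
      exact not_hasType_emb hj _
    · simp [seed, h] at hs
  · by_cases hj : j = i
    · subst hj
      simpa only [hline] using hw'
    · convert hy 1 j using 1
      funext k
      rw [one_mul]
      by_cases hk : k = 1
      · simp [hk, graft_one]
      · rw [graft_of hk]
        simp [seed, hj]
  · intro g hg
    rcases hr : syllables g with _ | ⟨⟨j, a⟩, r⟩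
    · obtain rfl := syllables_inj (hr.trans syllables_one.symm)
      exact graft_one
    · refine graft_of_seed_eq_none hr ?_
      by_cases hj : j = i
      · subst hj
        have := h1 (hd g) (Finset.mem_insert_of_mem (Finset.mem_image_of_mem _ hg))
        rw [hhd hr] at this
        rw [hseed, if_pos this]
      · simp [seed, hj]
  · rw [Letter.hasType_iff l, hline, h2]
    simp

theorem exists_rooted_approx (hW : ∀ i, IsRootedModel (S i) (E i) (l i) (W i)) (N : ℕ)
    (J : Set ι) {y : Monoid.CoprodI G → Letter L Q} (hy : y ∈ lineShift l W)
    (hJ : ∀ i ∈ J, ¬ HasType i (y 1)) (F : Finset (Monoid.CoprodI G))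
    (hF : ∀ g ∈ F, (∃ i ∈ J, StartsWith i g) ∨ (syllables g).length < N) :
    ∃ y' ∈ lineShift l W, (∀ g ∈ F, y' g = y g) ∧ ∃ g b, y' g = Sum.inl b := by
  classical
  induction N generalizing J y F with
  | zero =>
    obtain ⟨y', hy', h1, h2⟩ := exists_root hW J (y 1) y (fun _ => ⟨hy, rfl⟩) hJ
    exact ⟨y', hy', fun g hg => h2 g ((hF g hg).resolve_right (by omega)), 1, _, h1⟩
  | succ N ih =>
    rcases hasType_or_eq_inl (y 1) with ⟨i, hi⟩ | ⟨b, hb⟩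
    swap
    · exact ⟨y, hy, fun _ _ => rfl, 1, b, hb⟩
    have hiJ : i ∉ J := fun h => hJ i h hi
    obtain ⟨y₁, hy₁, h1, h2, h0, h3⟩ := exists_center_on_line hW hy i F
    have h01 : h0 ≠ 1 := by
      rintro rfl
      rw [map_one, h2] at h3
      exact h3 hi
    obtain ⟨y₂, hy₂, h4, g₀, b, h5⟩ := ih {i} (translate_mem_lineShift hy₁ (of h0))
      (by rintro j rfl; simpa using h3) (F.image fun g => (of h0)⁻¹ * g) (by
        intro g' hg'
        obtain ⟨g, hg, rfl⟩ := Finset.mem_image.1 hg'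
        rw [← map_inv]
        by_cases hgi : StartsWith i g
        · obtain ⟨k, r, hr⟩ := hgi
          obtain ⟨-, g', hr', hgi', rfl⟩ := exists_of_syllables_eq_cons hr
          rw [← mul_assoc, ← map_mul]
          by_cases hk : h0⁻¹ * k = 1
          · right
            have := (hF _ hg).resolve_left (by
              rintro ⟨j, hj, a, r', hr''⟩
              rw [hr, List.cons.injEq, Sigma.mk.injEq] at hr''
              exact hiJ (hr''.1.1 ▸ hj))
            rw [hr, List.length_cons] at this
            rw [hk, map_one, one_mul, hr']
            omega
          · exact .inl ⟨i, rfl, _, _, syllables_of_mul hgi' hk⟩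
        · exact .inl ⟨i, rfl, _, _, syllables_of_mul hgi (inv_ne_one.2 h01)⟩)
    refine ⟨fun g => y₂ ((of h0)⁻¹ * g), translate_mem_lineShift hy₂ _, fun g hg => ?_,
      of h0 * g₀, b, by simpa using h5⟩
    beta_reduce
    rw [h4 _ (Finset.mem_image_of_mem _ hg), mul_inv_cancel_left, h1 g hg]

theorem isIsolated_lineShift [Finite ι] (hW : ∀ i, IsRootedModel (S i) (E i) (l i) (W i)) :
    IsIsolated (Monoid.CoprodI G) (Letter L Q) (lineShift l W) := by
  classical
  refine ⟨isSFT_lineShift hW, {1}, fun Z hZ hZY hpat => hZY.2 fun y hy => ?_⟩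
  have hroot : ∀ y' ∈ lineShift l W, ∀ g b, y' g = Sum.inl b → y' ∈ Z := by
    intro y' hy' g b hb
    have hmem := translate_mem_lineShift hy' g
    obtain ⟨z, hz, hzy⟩ : (fun e : ({1} : Finset (Monoid.CoprodI G)) => y' (g * e)) ∈
        patterns {1} Z := by
      rw [hpat]
      exact ⟨_, hmem, rfl⟩
    have hz1 : z 1 = y' (g * 1) := congrFun hzy ⟨1, by simp⟩
    obtain rfl := IsRootedModel.eq_of_root hW (hZY.1 hz) hmem (b := b)
      (by rw [hz1, mul_one, hb]) (by rw [mul_one, hb])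
    have hshift : shift g (fun k => y' (g * k)) = y' := by
      funext k
      simp [shift]
    exact hshift ▸ hZ.2 g _ hz
  let _ : TopologicalSpace (Letter L Q) := ⊥
  have : DiscreteTopology (Letter L Q) := ⟨rfl⟩
  rw [← hZ.1.closure_eq, mem_closure_iff]
  intro U hU hyU
  obtain ⟨F, u, hu, hFU⟩ := isOpen_pi_iff.1 hU y hyU
  obtain ⟨y', hy', h1, g, b, h2⟩ := exists_rooted_approx hW
    (∑ g ∈ F, (syllables g).length + 1) ∅ hy (by simp) F fun g hg => .inr (Nat.lt_succ_of_le
      (Finset.single_le_sum (f := fun g => (syllables g).length) (fun _ _ => Nat.zero_le _) hg))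
  refine ⟨y', hFU fun g hg => ?_, hroot y' hy' g b h2⟩
  rw [h1 g hg]
  exact (hu g hg).2

end Graft

end Model

section Transport

variable {G B C : Type} [Group G]

theorem isIsolated_image_of_injective {j : B → C} (hj : Function.Injective j) {Y : Set (G → B)}
    (hY : IsIsolated G B Y) : IsIsolated G C ((fun y => j ∘ y) '' Y) := by
  classical
  obtain ⟨⟨E, 𝔽, hE⟩, F, hF⟩ := hY
  refine ⟨⟨insert 1 E, {p | (∃ b, j b = p ⟨1, Finset.mem_insert_self _ _⟩) ∧
    ∃ q ∈ 𝔽, ∀ e : E, p ⟨e, Finset.mem_insert_of_mem e.2⟩ = j (q e)}, fun x => ⟨?_, fun hx => ?_⟩⟩,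
    F, fun Z hZ hZY hpat => ?_⟩
  · rintro ⟨y, hy, rfl⟩ g
    exact ⟨⟨y (g⁻¹ * 1), rfl⟩, _, (hE y).1 hy g, fun e => rfl⟩
  · have hrange : ∀ k, ∃ b, j b = x k := fun k => by
      obtain ⟨b, hb⟩ := (hx k⁻¹).1
      exact ⟨b, by simpa [shift] using hb⟩
    choose y hy using hrange
    obtain rfl : j ∘ y = x := funext hy
    refine ⟨y, (hE y).2 fun g => ?_, rfl⟩
    obtain ⟨q, hq, hqe⟩ := (hx g).2
    convert hq using 1
    exact funext fun e => hj (hqe e)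
  · let Z' : Set (G → B) := (fun y => j ∘ y) ⁻¹' Z
    have hZ' : (fun y => j ∘ y) '' Z' = Z := Set.image_preimage_eq_of_subset fun z hz => by
      obtain ⟨y, -, rfl⟩ := hZY.1 hz
      exact ⟨y, rfl⟩
    have hsub : Z' ⊆ Y := fun z hz => by
      obtain ⟨y, hy, h⟩ := hZY.1 hz
      exact hj.comp_left h ▸ hy
    have hclosed : IsSubshift G B Z' := by
      constructor
      · let _ : TopologicalSpace B := ⊥
        let _ : TopologicalSpace C := ⊥
        have : DiscreteTopology B := ⟨rfl⟩
        exact hZ.1.preimage (continuous_pi fun g =>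
          continuous_of_discreteTopology.comp (continuous_apply g))
      · exact fun g z hz => hZ.2 g _ hz
    have himage : ∀ V : Set (G → B), patterns F ((fun y => j ∘ y) '' V) =
        (fun p => j ∘ p) '' patterns F V := fun V => by
      simp only [patterns, Set.image_image]
      rfl
    refine hF Z' hclosed ⟨hsub, fun h => hZY.2 ?_⟩ ?_
    · rintro _ ⟨y, hy, rfl⟩
      exact h hy
    · rw [← hZ', himage, himage] at hpat
      exact hj.comp_left.image_injective hpat

end Transport

section Density

open Monoid.CoprodI

variable {ι : Type} [Finite ι] {G : ι → Type} [∀ i, Group (G i)]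

theorem isolatedDense_coprodI (hG : ∀ i, Finite (G i) ∨ IsCyclic (G i)) :
    IsolatedDense (Monoid.CoprodI G) := by
  classical
  intro B _ _ X hX F
  let ev : List (Σ i, G i) → Monoid.CoprodI G := fun r => (r.map fun s => of s.2).prod
  let D : Finset (Monoid.CoprodI G) :=
    insert 1 (F.biUnion fun f => ((syllables f).tails.map ev).toFinset)
  have one_mem : 1 ∈ D := Finset.mem_insert_self _ _
  have ev_mem : ∀ f ∈ F, ∀ r, r <:+ syllables f → ev r ∈ D := fun f hf r hr =>
    Finset.mem_insert_of_mem (Finset.mem_biUnion.2 ⟨f, hf, List.mem_toFinset.2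
      (List.mem_map_of_mem ((List.mem_tails _ _).2 hr))⟩)
  have F_sub : F ⊆ D := fun f hf => by
    have := ev_mem f hf _ List.suffix_rfl
    rwa [show ev (syllables f) = f from prod_syllables f] at this
  let L : Type := {p : D → B // p ∈ patterns D X}
  let S : ∀ i, Finset (G i) := fun i =>
    (F.biUnion fun f => (syllables f).toFinset).preimage (Sigma.mk i)
      sigma_mk_injective.injOn
  have mem_S : ∀ f ∈ F, ∀ i (s : G i), ⟨i, s⟩ ∈ syllables f → s ∈ S i := fun f hf i s hs =>
    Finset.mem_preimage.2 (Finset.mem_biUnion.2 ⟨f, hf, List.mem_toFinset.2 hs⟩)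
  let E : ∀ i, G i → L → L → Prop := fun i s b b' =>
    ∀ (w : Monoid.CoprodI G) (hw : w ∈ D) (hsw : of s * w ∈ D), b.1 ⟨of s * w, hsw⟩ = b'.1 ⟨w, hw⟩
  have translate : ∀ x ∈ X, ∀ g, (fun k => x (g * k)) ∈ X := fun x hx g => by
    have hshift : shift g⁻¹ x = fun k => x (g * k) := by
      funext k
      simp [shift]
    exact hshift ▸ hX.2 g⁻¹ x hx
  have hE : ∀ i, ∀ b : L, ∃ u : G i → L, u 1 = b ∧ ∀ h, ∀ s ∈ S i, E i s (u h) (u (h * s)) := by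
    rintro i ⟨_, x, hx, rfl⟩
    refine ⟨fun h => ⟨fun w => x (of h * w), _, translate x hx (of h), rfl⟩, ?_, ?_⟩
    · simp
    · intro h s _ w hw hsw
      simp [mul_assoc]
  choose Q hQ l W hW using fun i => exists_isRootedModel (hG i) (S i) (E i) (hE i)
  have : Finite (Letter L Q) := inferInstanceAs (Finite (L ⊕ Σ i, Q i))
  let ψ : Letter L Q → B := fun a => (Letter.base l a).1 ⟨1, one_mem⟩
  have read : ∀ y ∈ lineShift l W, ∀ f (hf : f ∈ F) r (hr : r <:+ syllables f), ∀ g,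
      (Letter.base l (y g)).1 ⟨ev r, ev_mem f hf r hr⟩ = ψ (y (g * ev r)) := by
    intro y hy f hf r
    induction r with
    | nil => simp [ev, ψ]
    | cons s r ih =>
      obtain ⟨i, s⟩ := s
      intro hr g
      have hr' : r <:+ syllables f := (List.suffix_cons _ _).trans hr
      have hrel := (hW i).rel _ (hy g i) 1 s (mem_S f hf i s (hr.subset (by simp)))
      rw [Letter.elim_proj, Letter.elim_proj, map_one, mul_one, one_mul] at hrel
      have h1 := hrel (ev r) (ev_mem f hf r hr') (ev_mem f hf _ hr)
      rw [ih hr', mul_assoc] at h1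
      exact h1
  have read_F : ∀ y ∈ lineShift l W, ∀ f (hf : f ∈ F),
      (Letter.base l (y 1)).1 ⟨f, F_sub hf⟩ = ψ (y f) := by
    intro y hy f hf
    have := read y hy f hf _ List.suffix_rfl 1
    simpa only [show ev (syllables f) = f from prod_syllables f, one_mul] using this
  obtain ⟨m, ⟨e⟩⟩ := Finite.exists_equiv_fin (Letter L Q)
  let j : Letter L Q → Fin (m + 2) := fun a => Fin.castAdd 2 (e a)
  have hj : Function.Injective j := (Fin.castAdd_injective m 2).comp e.injective
  let l' : Fin (m + 2) → B := Function.extend j ψ fun _ => Classical.arbitrary B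
  have hl' : l' ∘ j = ψ := funext fun a => by
    simp only [l', Function.comp_apply, hj.extend_apply]
  refine ⟨m, (fun y => j ∘ y) '' lineShift l W, l',
    isIsolated_image_of_injective hj (isIsolated_lineShift hW), ?_⟩
  rw [Set.image_image]
  simp only [← Function.comp_assoc, hl']
  ext p
  constructor
  · rintro ⟨_, ⟨y, hy, rfl⟩, rfl⟩
    obtain ⟨x, hx, hxy⟩ := (Letter.base l (y 1)).2
    exact ⟨x, hx, funext fun f => (congrFun hxy ⟨f, F_sub f.2⟩).trans (read_F y hy f f.2)⟩
  · rintro ⟨x, hx, rfl⟩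
    let b : L := ⟨_, x, hx, rfl⟩
    obtain ⟨y, hy, hy1, -⟩ := exists_root hW ∅ (Sum.inl b) (fun _ => Sum.inl b) (by simp) (by simp)
    refine ⟨_, ⟨y, hy, rfl⟩, funext fun f => ?_⟩
    refine (read_F y hy f f.2).symm.trans ?_
    rw [hy1]
    rfl

theorem countable_coprodI (hG : ∀ i, Finite (G i) ∨ IsCyclic (G i)) :
    Countable (Monoid.CoprodI G) := by
  classical
  have : ∀ i, Countable (G i) := fun i => by
    rcases hG i with h | h
    · exact inferInstance
    · obtain ⟨g, hg⟩ := h.exists_generator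
      exact Function.Surjective.countable (f := fun n : ℤ => g ^ n) hg
  exact Function.Injective.countable (f := syllables) fun g g' => syllables_inj

end Density

section Image

variable {G A B : Type}

theorem continuousOnD_comp (l : B → A) (Y : Set (G → B)) :
    ContinuousOnD (fun y : G → B => l ∘ y) Y := by
  let _ : TopologicalSpace A := ⊥
  let _ : TopologicalSpace B := ⊥
  have : DiscreteTopology B := ⟨rfl⟩
  exact (continuous_pi fun g =>
    continuous_of_discreteTopology.comp (continuous_apply g)).continuousOn

variable [Group G]

theorem IsSubshift.image [Finite B] {Y : Set (G → B)} (hY : IsSubshift G B Y) (l : B → A) :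
    IsSubshift G A ((fun y => l ∘ y) '' Y) := by
  constructor
  · let _ : TopologicalSpace A := ⊥
    let _ : TopologicalSpace B := ⊥
    have : DiscreteTopology A := ⟨rfl⟩
    exact (hY.1.isCompact.image_of_continuousOn (continuousOnD_comp l Y)).isClosed
  · rintro g _ ⟨y, hy, rfl⟩
    exact ⟨_, hY.2 g y hy, rfl⟩

theorem IsIsolated.stronglyProjIsolated_image {m : ℕ} {Y : Set (G → Fin (m + 2))}
    (hY : IsIsolated G (Fin (m + 2)) Y) (l : Fin (m + 2) → A) :
    StronglyProjIsolated G A ((fun y => l ∘ y) '' Y) :=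
  ⟨Fin (m + 2), inferInstance, inferInstance, Y, fun y => l ∘ y, hY.1.isSubshift, hY,
    continuousOnD_comp l Y, fun _ _ _ => rfl, rfl⟩

end Image

/-- A free product of finitely many groups, each finite or cyclic,
has the strong topological Rokhlin property; moreover strongly projectively isolated
subshifts are dense over it. -/
theorem strp_of_freeProduct_finite_or_cyclic (n : ℕ) (hn : 1 ≤ n)
    (Gi : Fin n → Type) [∀ i, Group (Gi i)]
    (hfc : ∀ i, Finite (Gi i) ∨ IsCyclic (Gi i)) :
    HasSTRP (Monoid.CoprodI Gi) ∧
      ∀ (A : Type) (_ : Fintype A) (_ : Nontrivial A)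
        (X : Set (Monoid.CoprodI Gi → A)),
        IsSubshift (Monoid.CoprodI Gi) A X →
        ∀ F : Finset (Monoid.CoprodI Gi),
          ∃ X' : Set (Monoid.CoprodI Gi → A),
            IsSubshift (Monoid.CoprodI Gi) A X' ∧
            StronglyProjIsolated (Monoid.CoprodI Gi) A X' ∧
            patterns F X' = patterns F X := by
  have hdense := isolatedDense_coprodI hfc
  have := countable_coprodI hfc
  refine ⟨hdense.hasSTRP, fun A _ _ X hX F => ?_⟩
  obtain ⟨m, Y, l, hY, hpat⟩ := hdense A X hX F
  exact ⟨_, hY.1.isSubshift.image l, hY.stronglyProjIsolated_image l, hpat⟩
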